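/- arXiv:1812.00916 — 10 statements merged into one kernel-verified Lean document; each statement's English description precedes it below -/
import Mathlib

section
/- Let m ≥ 1 and d₁,…,d_m ≥ 1 be integers. For each i = 1,…,m let C_i ⊆ ℝ^{d_i} be a convex body (a compact convex set with nonempty interior) containing the origin, and let k_i > 0 be a real dilation factor. Then the lattice width of the direct sum C := k₁C₁ ⊕ ⋯ ⊕ k_mC_m ⊆ ℝ^{d₁+⋯+d_m} with respect to ℤ^{d₁+⋯+d_m} equals min_{1≤i≤m} k_i · (lattice width of C_i with respect to ℤ^{d_i}). -/
open Set Pointwise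

/-- The lattice width of a set `K ⊆ ℝ^ι` with respect to the integer lattice `ℤ^ι`:
the infimum, over nonzero linear functionals mapping integer points to integers,
of `sup f(K) - inf f(K)`. -/
noncomputable def latticeWidth {ι : Type*} (K : Set (ι → ℝ)) : ℝ :=
  sInf { w : ℝ | ∃ f : (ι → ℝ) →ₗ[ℝ] ℝ,
    (∀ v : ι → ℤ, ∃ k : ℤ, f (fun i => (v i : ℝ)) = (k : ℝ)) ∧ f ≠ 0 ∧
    w = sSup (f '' K) - sInf (f '' K) }

/-- The direct (free) sum of sets `C i ⊆ ℝ^{d i}`, each containing the origin,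
inside `ℝ^{d 1 + ⋯ + d m}` (realized as functions on the sigma type). -/
def dirSum {m : ℕ} {d : Fin m → ℕ} (C : (i : Fin m) → Set (Fin (d i) → ℝ)) :
    Set ((Σ i : Fin m, Fin (d i)) → ℝ) :=
  { x | ∃ (lam : Fin m → ℝ) (y : (i : Fin m) → Fin (d i) → ℝ),
      (∀ i, 0 ≤ lam i) ∧ (∑ i, lam i = 1) ∧ (∀ i, y i ∈ C i) ∧
      (∀ i j, x ⟨i, j⟩ = lam i * y i j) }

theorem latticeWidth_smul {ι : Type*} (K : Set (ι → ℝ)) {r : ℝ} (hr : 0 ≤ r) :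
    latticeWidth (r • K) = r * latticeWidth K := by
  have hwidth (f : (ι → ℝ) →ₗ[ℝ] ℝ) :
      sSup (f '' (r • K)) - sInf (f '' (r • K)) = r • (sSup (f '' K) - sInf (f '' K)) := by
    rw [image_smul_set, Real.sSup_smul_of_nonneg hr, Real.sInf_smul_of_nonneg hr, smul_sub]
  unfold latticeWidth
  rw [← smul_eq_mul, ← Real.sInf_smul_of_nonneg hr]
  congr 1
  ext w
  simp only [hwidth, mem_smul_set, mem_ofPred_eq]
  constructor
  · rintro ⟨f, hf, hf0, rfl⟩
    exact ⟨_, ⟨f, hf, hf0, rfl⟩, rfl⟩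
  · rintro ⟨_, ⟨f, hf, hf0, rfl⟩, rfl⟩
    exact ⟨f, hf, hf0, rfl⟩

theorem isCompact_image_linearMap {ι : Type*} [Finite ι] {K : Set (ι → ℝ)} (hK : IsCompact K)
    (f : (ι → ℝ) →ₗ[ℝ] ℝ) : IsCompact (f '' K) :=
  hK.image f.continuous_of_finiteDimensional

/-- The lattice width is at most the width with respect to any nonzero integer functional. -/
theorem latticeWidth_le {ι : Type*} [Finite ι] {K : Set (ι → ℝ)} (hK : IsCompact K)
    (f : (ι → ℝ) →ₗ[ℝ] ℝ)
    (hf : ∀ v : ι → ℤ, ∃ k : ℤ, f (fun i => (v i : ℝ)) = (k : ℝ)) (hf0 : f ≠ 0) :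
    latticeWidth K ≤ sSup (f '' K) - sInf (f '' K) := by
  refine csInf_le ⟨0, ?_⟩ ⟨f, hf, hf0, rfl⟩
  rintro _ ⟨g, -, -, rfl⟩
  have hg := isCompact_image_linearMap hK g
  exact sub_nonneg.2 (Real.sInf_le_sSup _ hg.bddBelow hg.bddAbove)

/-- A lower bound for the width with respect to every nonzero integer functional is a lower bound
for the lattice width. -/
theorem le_latticeWidth {ι : Type*} [Nonempty ι] {K : Set (ι → ℝ)} {a : ℝ}
    (h : ∀ f : (ι → ℝ) →ₗ[ℝ] ℝ,
      (∀ v : ι → ℤ, ∃ k : ℤ, f (fun i => (v i : ℝ)) = (k : ℝ)) → f ≠ 0 →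
      a ≤ sSup (f '' K) - sInf (f '' K)) :
    a ≤ latticeWidth K := by
  refine le_csInf ?_ ?_
  · obtain ⟨i⟩ := ‹Nonempty ι›
    refine ⟨_, LinearMap.proj i, fun v => ⟨v i, rfl⟩, fun h0 => ?_, rfl⟩
    simpa using LinearMap.congr_fun h0 1
  · rintro _ ⟨f, hf, hf0, rfl⟩
    exact h f hf hf0

theorem isCompact_dirSum {m : ℕ} {d : Fin m → ℕ} {C : (i : Fin m) → Set (Fin (d i) → ℝ)}
    (hC : ∀ i, IsCompact (C i)) : IsCompact (dirSum C) := by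
  let F : (Fin m → ℝ) × ((i : Fin m) → Fin (d i) → ℝ) → (Σ i : Fin m, Fin (d i)) → ℝ :=
    fun p s => p.1 s.1 * p.2 s.1 s.2
  have hF : Continuous F := by fun_prop
  convert ((isCompact_stdSimplex ℝ (Fin m)).prod (isCompact_univ_pi hC)).image hF
  ext x
  constructor
  · rintro ⟨lam, y, h0, h1, hy, hx⟩
    exact ⟨(lam, y), ⟨⟨h0, h1⟩, fun i _ => hy i⟩, funext fun s => (hx s.1 s.2).symm⟩
  · rintro ⟨⟨lam, y⟩, ⟨⟨h0, h1⟩, hy⟩, rfl⟩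
    exact ⟨lam, y, h0, h1, fun i => hy i trivial, fun _ _ => rfl⟩

section blocks

variable {m : ℕ} {d : Fin m → ℕ}

/-- The position, among all coordinates, of a coordinate of the `i`-th block. -/
def blockIndex (i : Fin m) (j : Fin (d i)) : Σ i : Fin m, Fin (d i) := ⟨i, j⟩

theorem blockIndex_injective (i : Fin m) : Function.Injective (blockIndex (d := d) i) :=
  fun _ _ h => eq_of_heq (Sigma.mk.inj h).2

/-- The inclusion of the `i`-th block of coordinates. -/
noncomputable def blockInclusion (i : Fin m) :
    (Fin (d i) → ℝ) →ₗ[ℝ] ((Σ i : Fin m, Fin (d i)) → ℝ) :=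
  Function.ExtendByZero.linearMap ℝ (blockIndex i)

@[simp]
theorem blockInclusion_apply_self (i : Fin m) (v : Fin (d i) → ℝ) (j : Fin (d i)) :
    blockInclusion i v ⟨i, j⟩ = v j :=
  (blockIndex_injective i).extend_apply _ _ _

theorem blockInclusion_apply_of_ne {i i' : Fin m} (h : i' ≠ i) (v : Fin (d i) → ℝ)
    (j : Fin (d i')) : blockInclusion i v ⟨i', j⟩ = 0 :=
  Function.extend_apply' _ _ _ fun ⟨_, hj⟩ => h (congrArg Sigma.fst hj).symm

theorem blockInclusion_intCast (i : Fin m) (v : Fin (d i) → ℤ) :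
    ∃ w : (Σ i : Fin m, Fin (d i)) → ℤ,
      blockInclusion i (fun j => (v j : ℝ)) = fun s => (w s : ℝ) := by
  refine ⟨Function.extend (blockIndex i) v 0, funext fun ⟨i', j⟩ => ?_⟩
  obtain rfl | h := eq_or_ne i' i
  · exact (blockInclusion_apply_self _ _ _).trans
      (congrArg _ ((blockIndex_injective i').extend_apply v 0 j).symm)
  · rw [blockInclusion_apply_of_ne h, Function.extend_apply', Pi.zero_apply, Int.cast_zero]
    exact fun ⟨_, hj⟩ => h (congrArg Sigma.fst hj).symm

theorem exists_comp_blockInclusion_ne_zero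
    {f : ((Σ i : Fin m, Fin (d i)) → ℝ) →ₗ[ℝ] ℝ} (hf : f ≠ 0) :
    ∃ i, f ∘ₗ blockInclusion i ≠ 0 := by
  by_contra! h
  refine hf (LinearMap.pi_ext fun ⟨i, j⟩ r => ?_)
  have hs : Pi.single (⟨i, j⟩ : Σ i : Fin m, Fin (d i)) r =
      blockInclusion i (Pi.single j r) := by
    ext ⟨i', j'⟩
    obtain rfl | hne := eq_or_ne i' i
    · simp [Pi.single_apply]
    · rw [blockInclusion_apply_of_ne hne, Pi.single_apply, if_neg]
      exact fun hj => hne (congrArg Sigma.fst hj)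
  rw [hs]
  exact LinearMap.congr_fun (h i) _

theorem blockInclusion_mem_dirSum {C : (i : Fin m) → Set (Fin (d i) → ℝ)}
    (h0 : ∀ i, 0 ∈ C i) {i : Fin m} {v : Fin (d i) → ℝ} (hv : v ∈ C i) :
    blockInclusion i v ∈ dirSum C := by
  classical
  refine ⟨Pi.single i 1, Function.update 0 i v, fun i' => ?_, by simp, fun i' => ?_,
    fun i' j => ?_⟩
  · exact (Pi.single_nonneg.2 zero_le_one : (0 : Fin m → ℝ) ≤ Pi.single i 1) i'
  · obtain rfl | h := eq_or_ne i' i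
    · simpa using hv
    · simpa [h] using h0 i'
  · obtain rfl | h := eq_or_ne i' i
    · simp
    · simp [blockInclusion_apply_of_ne h, h]

theorem block_mem_of_mem_dirSum {C : (i : Fin m) → Set (Fin (d i) → ℝ)}
    (h0 : ∀ i, 0 ∈ C i) (hC : ∀ i, Convex ℝ (C i)) {x : (Σ i : Fin m, Fin (d i)) → ℝ}
    (hx : x ∈ dirSum C) (i : Fin m) : (fun j => x ⟨i, j⟩) ∈ C i := by
  obtain ⟨lam, y, hl0, hl1, hy, hxy⟩ := hx
  have hle : lam i ≤ 1 := hl1 ▸ Finset.single_le_sum (fun i _ => hl0 i) (Finset.mem_univ i)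
  have hxi : (fun j => x ⟨i, j⟩) = lam i • y i := funext (hxy i)
  exact hxi ▸ (hC i).smul_mem_of_zero_mem (h0 i) (hy i) ⟨hl0 i, hle⟩

theorem image_block_dirSum {C : (i : Fin m) → Set (Fin (d i) → ℝ)}
    (h0 : ∀ i, 0 ∈ C i) (hC : ∀ i, Convex ℝ (C i)) (i : Fin m) :
    LinearMap.funLeft ℝ ℝ (blockIndex i) '' dirSum C = C i := by
  ext v
  constructor
  · rintro ⟨x, hx, rfl⟩
    exact block_mem_of_mem_dirSum h0 hC hx i
  · exact fun hv => ⟨_, blockInclusion_mem_dirSum h0 hv, funext (blockInclusion_apply_self i v)⟩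

theorem latticeWidth_dirSum_le {C : (i : Fin m) → Set (Fin (d i) → ℝ)}
    (hd : ∀ i, 1 ≤ d i) (hcomp : ∀ i, IsCompact (C i)) (hC : ∀ i, Convex ℝ (C i))
    (h0 : ∀ i, 0 ∈ C i) (i : Fin m) : latticeWidth (dirSum C) ≤ latticeWidth (C i) := by
  have : Nonempty (Fin (d i)) := ⟨⟨0, hd i⟩⟩
  refine le_latticeWidth fun f hf hf0 => ?_
  have h := latticeWidth_le (isCompact_dirSum hcomp)
    (f ∘ₗ LinearMap.funLeft ℝ ℝ (blockIndex i)) (fun v => hf fun j => v ⟨i, j⟩) fun hz => hf0 ?_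
  · rwa [LinearMap.coe_comp, image_comp, image_block_dirSum h0 hC] at h
  · ext1 j
    ext
    have hv : LinearMap.funLeft ℝ ℝ (blockIndex i) (blockInclusion i (Pi.single j 1)) =
      Pi.single j 1 := funext (blockInclusion_apply_self i _)
    have := LinearMap.congr_fun hz (blockInclusion i (Pi.single j 1))
    rw [LinearMap.comp_apply, hv] at this
    simpa using this

theorem exists_latticeWidth_le_width {C : (i : Fin m) → Set (Fin (d i) → ℝ)}
    (hcomp : ∀ i, IsCompact (C i)) (h0 : ∀ i, 0 ∈ C i)
    {f : ((Σ i : Fin m, Fin (d i)) → ℝ) →ₗ[ℝ] ℝ}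
    (hf : ∀ v : (Σ i : Fin m, Fin (d i)) → ℤ, ∃ k : ℤ, f (fun s => (v s : ℝ)) = (k : ℝ))
    (hf0 : f ≠ 0) :
    ∃ i, latticeWidth (C i) ≤ sSup (f '' dirSum C) - sInf (f '' dirSum C) := by
  obtain ⟨i, hi⟩ := exists_comp_blockInclusion_ne_zero hf0
  refine ⟨i, (latticeWidth_le (hcomp i) _ (fun v => ?_) hi).trans ?_⟩
  · obtain ⟨w, hw⟩ := blockInclusion_intCast i v
    rw [LinearMap.comp_apply, hw]
    exact hf w
  · have hsub : (f ∘ₗ blockInclusion i) '' C i ⊆ f '' dirSum C := by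
      rintro _ ⟨v, hv, rfl⟩
      exact ⟨_, blockInclusion_mem_dirSum h0 hv, rfl⟩
    have hne : ((f ∘ₗ blockInclusion i) '' C i).Nonempty := ⟨_, 0, h0 i, rfl⟩
    have hcpt := isCompact_image_linearMap (isCompact_dirSum hcomp) f
    exact sub_le_sub (csSup_le_csSup hcpt.bddAbove hne hsub)
      (csInf_le_csInf hcpt.bddBelow hne hsub)

end blocks

theorem latticeWidth_dirSum (m : ℕ) (hm : 1 ≤ m) (d : Fin m → ℕ) (hd : ∀ i, 1 ≤ d i)
    (C : (i : Fin m) → Set (Fin (d i) → ℝ))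
    (hcomp : ∀ i, IsCompact (C i)) (hconv : ∀ i, Convex ℝ (C i))
    (hint : ∀ i, (interior (C i)).Nonempty)
    (h0 : ∀ i, (0 : Fin (d i) → ℝ) ∈ C i)
    (k : Fin m → ℝ) (hk : ∀ i, 0 < k i) :
    latticeWidth (dirSum (fun i => k i • C i)) = ⨅ i, k i * latticeWidth (C i) := by
  have : NeZero m := ⟨by lia⟩
  have hcomp' (i : Fin m) : IsCompact (k i • C i) := (hcomp i).smul (k i)
  have h0' (i : Fin m) : (0 : Fin (d i) → ℝ) ∈ k i • C i := ⟨0, h0 i, smul_zero _⟩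
  have : Nonempty (Σ i : Fin m, Fin (d i)) := ⟨0, 0, hd 0⟩
  simp_rw [← fun i => latticeWidth_smul (C i) (hk i).le]
  refine le_antisymm
    (le_ciInf (latticeWidth_dirSum_le hd hcomp' (fun i => (hconv i).smul (k i)) h0'))
    (le_latticeWidth fun f hf hf0 => ?_)
  obtain ⟨i, hi⟩ := exists_latticeWidth_le_width hcomp' h0' hf hf0
  exact (ciInf_le (finite_range _).bddBelow i).trans hi
end

section
/- Let m ≥ 1 and d₁,…,d_m ≥ 1 be integers. For each i = 1,…,m let C_i ⊆ ℝ^{d_i} be a convex body (a compact convex set with nonempty interior) containing the origin, and let k_i > 0 be real numbers. If every C_i is hollow (its interior contains no point of ℤ^{d_i}) and ∑_{i=1}^m 1/k_i ≥ 1, then the direct sum k₁C₁ ⊕ ⋯ ⊕ k_mC_m ⊆ ℝ^{d₁+⋯+d_m} is hollow, i.e., its interior contains no point of ℤ^{d₁+⋯+d_m}. -/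
open Set Pointwise

/-- A point at which a nonzero continuous linear functional attains its maximum over a set
is not an interior point of that set. -/
theorem notMem_interior_of_forall_le {E : Type*} [NormedAddCommGroup E] [NormedSpace ℝ E]
    {s : Set E} {x : E} (f : E →L[ℝ] ℝ) (hf : f ≠ 0) (h : ∀ y ∈ s, f y ≤ f x) :
    x ∉ interior s := by
  intro hx
  have hmax : IsLocalMax f x := by
    filter_upwards [mem_interior_iff_mem_nhds.1 hx] with y hy using h y hy
  exact hf (hmax.hasFDerivAt_eq_zero f.hasFDerivAt)

/-- A point outside the interior of a convex body is weakly separated from the body by a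
nonzero functional. -/
theorem exists_ne_zero_forall_le_of_notMem_interior {E : Type*} [NormedAddCommGroup E]
    [NormedSpace ℝ E] {s : Set E} (hs : Convex ℝ s) (hne : (interior s).Nonempty) {x : E}
    (hx : x ∉ interior s) : ∃ f : E →L[ℝ] ℝ, f ≠ 0 ∧ ∀ y ∈ s, f y ≤ f x := by
  obtain ⟨f, hf⟩ := geometric_hahn_banach_open_point hs.interior isOpen_interior hx
  refine ⟨f, ?_, fun y hy => ?_⟩
  · rintro rfl
    obtain ⟨y, hy⟩ := hne
    simpa using hf y hy
  · have hy' : y ∈ closure (interior s) := by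
      rw [hs.closure_interior_eq_closure_of_nonempty_interior hne]
      exact subset_closure hy
    exact closure_minimal (fun a ha => (hf a ha).le)
      (isClosed_le f.continuous continuous_const) hy'

/-- The projection of `ℝ^{d 1 + ⋯ + d m}` onto its `i`-th block of coordinates. -/
def blockProj {m : ℕ} {d : Fin m → ℕ} (i : Fin m) :
    ((Σ i : Fin m, Fin (d i)) → ℝ) →L[ℝ] (Fin (d i) → ℝ) :=
  ContinuousLinearMap.pi fun j => ContinuousLinearMap.proj ⟨i, j⟩

theorem blockProj_apply {m : ℕ} {d : Fin m → ℕ} (i : Fin m)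
    (x : (Σ i : Fin m, Fin (d i)) → ℝ) : blockProj i x = fun j => x ⟨i, j⟩ := rfl

theorem blockProj_surjective {m : ℕ} {d : Fin m → ℕ} (i : Fin m) :
    Function.Surjective (blockProj (d := d) i) := fun v =>
  ⟨fun p => Function.update (0 : (i : Fin m) → Fin (d i) → ℝ) i v p.1 p.2, by
    ext j; simp [blockProj_apply]⟩

/-- The blocks of a point of `k 1 • C 1 ⊕ ⋯ ⊕ k m • C m`. -/
theorem exists_blockProj_eq_of_mem_dirSum {m : ℕ} {d : Fin m → ℕ}
    {C : (i : Fin m) → Set (Fin (d i) → ℝ)} {k : Fin m → ℝ}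
    {x : (Σ i : Fin m, Fin (d i)) → ℝ} (hx : x ∈ dirSum (fun i => k i • C i)) :
    ∃ (lam : Fin m → ℝ) (c : (i : Fin m) → Fin (d i) → ℝ), (∀ i, 0 ≤ lam i) ∧
      ∑ i, lam i = 1 ∧ (∀ i, c i ∈ C i) ∧ ∀ i, blockProj i x = (lam i * k i) • c i := by
  obtain ⟨lam, y, hlam, hsum, hy, hxy⟩ := hx
  choose c hc hcy using hy
  refine ⟨lam, c, hlam, hsum, hc, fun i => ?_⟩
  ext j
  simp [blockProj_apply, hxy, ← hcy, mul_assoc]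

theorem hollow_dirSum (m : ℕ) (hm : 1 ≤ m) (d : Fin m → ℕ) (hd : ∀ i, 1 ≤ d i)
    (C : (i : Fin m) → Set (Fin (d i) → ℝ))
    (hcomp : ∀ i, IsCompact (C i)) (hconv : ∀ i, Convex ℝ (C i))
    (hint : ∀ i, (interior (C i)).Nonempty)
    (h0 : ∀ i, (0 : Fin (d i) → ℝ) ∈ C i)
    (k : Fin m → ℝ) (hk : ∀ i, 0 < k i)
    (hhollow : ∀ i, ∀ z : Fin (d i) → ℤ, (fun j => (z j : ℝ)) ∉ interior (C i))
    (hksum : 1 ≤ ∑ i, (k i)⁻¹) :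
    ∀ z : (Σ i : Fin m, Fin (d i)) → ℤ,
      (fun p => (z p : ℝ)) ∉ interior (dirSum (fun i => k i • C i)) := by
  intro z
  set x : (Σ i : Fin m, Fin (d i)) → ℝ := fun p => (z p : ℝ) with hx
  choose f hf0 hf using fun i => exists_ne_zero_forall_le_of_notMem_interior (hconv i) (hint i)
    (hhollow i fun j => z ⟨i, j⟩)
  replace hf : ∀ i, ∀ y ∈ C i, f i y ≤ f i (blockProj i x) := hf
  have hnonneg : ∀ i, 0 ≤ f i (blockProj i x) := fun i => by simpa using hf i 0 (h0 i)
  by_cases hpos : ∀ i, 0 < f i (blockProj i x)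
  · let F : ((Σ i : Fin m, Fin (d i)) → ℝ) →L[ℝ] ℝ :=
      ∑ i, (k i * f i (blockProj i x))⁻¹ • (f i).comp (blockProj i)
    have hF : ∀ y, F y = ∑ i, (k i * f i (blockProj i x))⁻¹ * f i (blockProj i y) := fun y => by
      simp [F]
    have hFx : 1 ≤ F x := by
      rw [hF]
      refine hksum.trans_eq (Finset.sum_congr rfl fun i _ => ?_)
      have := (hpos i).ne'
      have := (hk i).ne'
      field_simp
    refine notMem_interior_of_forall_le F (fun h => ?_) fun y hy => le_trans ?_ hFx
    · rw [h] at hFx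
      norm_num at hFx
    · obtain ⟨lam, c, hlam, hsum, hc, hyc⟩ := exists_blockProj_eq_of_mem_dirSum hy
      rw [hF, ← hsum]
      refine Finset.sum_le_sum fun i _ => ?_
      have := hpos i
      have := hk i
      rw [hyc, map_smul, smul_eq_mul, inv_mul_le_iff₀ (by positivity)]
      calc lam i * k i * f i (c i) ≤ lam i * k i * f i (blockProj i x) :=
            mul_le_mul_of_nonneg_left (hf i _ (hc i)) (mul_nonneg (hlam i) (hk i).le)
        _ = k i * f i (blockProj i x) * lam i := by ring
  · push Not at hpos
    obtain ⟨i, hi⟩ := hpos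
    refine notMem_interior_of_forall_le ((f i).comp (blockProj i)) (fun h => hf0 i ?_)
      fun y hy => le_trans ?_ (hnonneg i)
    · ext1 v
      obtain ⟨w, rfl⟩ := blockProj_surjective i v
      exact DFunLike.congr_fun h w
    · obtain ⟨lam, c, hlam, -, hc, hyc⟩ := exists_blockProj_eq_of_mem_dirSum hy
      rw [ContinuousLinearMap.comp_apply, hyc, map_smul, smul_eq_mul]
      exact mul_nonpos_of_nonneg_of_nonpos (mul_nonneg (hlam i) (hk i).le)
        ((hf i _ (hc i)).trans hi)
end

section
/- Let Λ := {(a, b√3) ∈ ℝ² : 2a ∈ ℤ, 2b ∈ ℤ, a + b ∈ ℤ} be the triangular lattice generated by (1,0) and (1/2, √3/2), and let T ⊆ ℝ² be the triangle with vertices (−4/7, 2√3/7), (17/14, 9√3/14) and (6/7, −3√3/7). Then the interior of T contains no point of Λ, and the lattice width of T with respect to Λ equals 15/7. -/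
open Set

/-- The lattice width of a set `K ⊆ ℝ^ι` with respect to a lattice `Λ ⊆ ℝ^ι`:
the infimum, over nonzero linear functionals mapping points of `Λ` to integers,
of `sup f(K) - inf f(K)`. -/
noncomputable def latticeWidthIn {ι : Type*} (Λ : Set (ι → ℝ)) (K : Set (ι → ℝ)) : ℝ :=
  sInf { w : ℝ | ∃ f : (ι → ℝ) →ₗ[ℝ] ℝ,
    (∀ v ∈ Λ, ∃ k : ℤ, f v = (k : ℝ)) ∧ f ≠ 0 ∧
    w = sSup (f '' K) - sInf (f '' K) }

/-- The triangular lattice `{(a, b√3) : 2a ∈ ℤ, 2b ∈ ℤ, a + b ∈ ℤ}`. -/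
def triLattice : Set (Fin 2 → ℝ) :=
  { p | ∃ a b : ℝ, p = ![a, b * Real.sqrt 3] ∧
      (∃ n : ℤ, 2 * a = (n : ℝ)) ∧ (∃ n : ℤ, 2 * b = (n : ℝ)) ∧
      (∃ n : ℤ, a + b = (n : ℝ)) }

/-- The triangle `T` with vertices `(−4/7, 2√3/7)`, `(17/14, 9√3/14)`, `(6/7, −3√3/7)`. -/
noncomputable def triangleT : Set (Fin 2 → ℝ) :=
  convexHull ℝ {![-4/7, 2 * Real.sqrt 3 / 7], ![17/14, 9 * Real.sqrt 3 / 14],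
    ![6/7, -3 * Real.sqrt 3 / 7]}

/-- The coordinate along `(1, 0)` in the lattice basis `(1, 0)`, `(1/2, √3/2)`. -/
noncomputable def latCoordFst : (Fin 2 → ℝ) →ₗ[ℝ] ℝ :=
  LinearMap.proj 0 - (Real.sqrt 3)⁻¹ • LinearMap.proj 1

/-- The coordinate along `(1/2, √3/2)` in the lattice basis `(1, 0)`, `(1/2, √3/2)`. -/
noncomputable def latCoordSnd : (Fin 2 → ℝ) →ₗ[ℝ] ℝ :=
  (2 * (Real.sqrt 3)⁻¹) • LinearMap.proj 1

lemma latCoordFst_apply (a b : ℝ) : latCoordFst ![a, b * Real.sqrt 3] = a - b := by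
  have h : Real.sqrt 3 ≠ 0 := by positivity
  simp [latCoordFst]
  field_simp

lemma latCoordSnd_apply (a b : ℝ) : latCoordSnd ![a, b * Real.sqrt 3] = 2 * b := by
  have h : Real.sqrt 3 ≠ 0 := by positivity
  simp [latCoordSnd]
  field_simp

lemma exists_int_latCoord {v : Fin 2 → ℝ} (hv : v ∈ triLattice) :
    ∃ m n : ℤ, latCoordFst v = m ∧ latCoordSnd v = n := by
  obtain ⟨a, b, rfl, -, ⟨n, hn⟩, ⟨k, hk⟩⟩ := hv
  refine ⟨k - n, n, ?_, ?_⟩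
  · rw [latCoordFst_apply]; push_cast; linarith
  · rw [latCoordSnd_apply, hn]

lemma linearMap_eq_latCoord (f : (Fin 2 → ℝ) →ₗ[ℝ] ℝ) (v : Fin 2 → ℝ) :
    f v = f ![1, 0 * Real.sqrt 3] * latCoordFst v
      + f ![1 / 2, 1 / 2 * Real.sqrt 3] * latCoordSnd v := by
  have h : Real.sqrt 3 ≠ 0 := by positivity
  have hv : v = latCoordFst v • ![1, 0 * Real.sqrt 3]
      + latCoordSnd v • ![1 / 2, 1 / 2 * Real.sqrt 3] := by
    ext i
    fin_cases i
    · simp [latCoordFst, latCoordSnd]; ring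
    · simp [latCoordSnd]; field_simp
  conv_lhs => rw [hv]
  simp only [map_add, map_smul, smul_eq_mul]
  ring

lemma triangleT_eq : triangleT = convexHull ℝ {![-4 / 7, 2 / 7 * Real.sqrt 3],
    ![17 / 14, 9 / 14 * Real.sqrt 3], ![6 / 7, -3 / 7 * Real.sqrt 3]} := by
  simp only [triangleT, mul_div_right_comm]

lemma vertices_subset_triangleT : ({![-4 / 7, 2 / 7 * Real.sqrt 3],
    ![17 / 14, 9 / 14 * Real.sqrt 3], ![6 / 7, -3 / 7 * Real.sqrt 3]} : Set (Fin 2 → ℝ))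
      ⊆ triangleT :=
  triangleT_eq ▸ subset_convexHull ℝ _

lemma isCompact_triangleT : IsCompact triangleT :=
  Set.Finite.isCompact_convexHull (𝕜 := ℝ) (by simp)

lemma le_of_mem_triangleT (f : (Fin 2 → ℝ) →ₗ[ℝ] ℝ) {c : ℝ}
    (h₁ : f ![-4 / 7, 2 / 7 * Real.sqrt 3] ≤ c) (h₂ : f ![17 / 14, 9 / 14 * Real.sqrt 3] ≤ c)
    (h₃ : f ![6 / 7, -3 / 7 * Real.sqrt 3] ≤ c) {v : Fin 2 → ℝ} (hv : v ∈ triangleT) :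
    f v ≤ c := by
  rw [triangleT_eq] at hv
  refine convexHull_min (t := {w | f w ≤ c}) ?_ (convex_halfSpace_le f.isLinear c) hv
  rintro w (rfl | rfl | rfl) <;> assumption

/-- A nonzero linear functional does not attain its maximum over a set in the interior. -/
lemma LinearMap.lt_of_mem_interior {E : Type*} [AddCommGroup E] [Module ℝ E] [TopologicalSpace E]
    [ContinuousAdd E] [ContinuousSMul ℝ E] (f : E →ₗ[ℝ] ℝ) {K : Set E} {c : ℝ} (hf : f ≠ 0)
    (hK : ∀ w ∈ K, f w ≤ c) {v : E} (hv : v ∈ interior K) : f v < c := by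
  obtain ⟨w, hw⟩ := f.surjective hf 1
  have hcont : Continuous fun t : ℝ => v + t • w := by fun_prop
  have hmem : (fun t : ℝ => v + t • w) ⁻¹' interior K ∈ nhds (0 : ℝ) :=
    (isOpen_interior.preimage hcont).mem_nhds (by simpa using hv)
  obtain ⟨ε, hε, hball⟩ := Metric.mem_nhds_iff.1 hmem
  have hin : ε / 2 ∈ Metric.ball (0 : ℝ) ε := by
    rw [Metric.mem_ball, Real.dist_0_eq_abs, abs_of_pos (by positivity)]; linarith
  have := hK _ (interior_subset (hball hin))
  simp only [map_add, map_smul, hw, smul_eq_mul] at this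
  linarith

lemma lt_of_mem_interior_triangleT (p q : ℝ) {c : ℝ} (h₁ : (-6 * p + 4 * q) / 7 ≤ c)
    (h₂ : (4 * p + 9 * q) / 7 ≤ c) (h₃ : (9 * p - 6 * q) / 7 ≤ c) (hpq : p ≠ 0)
    {v : Fin 2 → ℝ} (hv : v ∈ interior triangleT) :
    p * latCoordFst v + q * latCoordSnd v < c := by
  refine (p • latCoordFst + q • latCoordSnd).lt_of_mem_interior ?_
    (fun w hw => le_of_mem_triangleT _ ?_ ?_ ?_ hw) hv
  · intro h
    apply hpq
    have := LinearMap.congr_fun h ![1, 0 * Real.sqrt 3]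
    simpa only [LinearMap.add_apply, LinearMap.smul_apply, latCoordFst_apply, latCoordSnd_apply,
      smul_eq_mul, LinearMap.zero_apply, mul_zero, sub_zero, add_zero, mul_one] using this
  all_goals
    simp only [LinearMap.add_apply, LinearMap.smul_apply, latCoordFst_apply, latCoordSnd_apply,
      smul_eq_mul]
    linarith

lemma notMem_interior_triangleT {v : Fin 2 → ℝ} (hv : v ∈ triLattice) :
    v ∉ interior triangleT := by
  intro h
  obtain ⟨m, n, hm, hn⟩ := exists_int_latCoord hv
  have h₁ := lt_of_mem_interior_triangleT (-1) 2 (c := 2) (by norm_num) (by norm_num)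
    (by norm_num) (by norm_num) h
  have h₂ := lt_of_mem_interior_triangleT 3 1 (c := 3) (by norm_num) (by norm_num)
    (by norm_num) (by norm_num) h
  have h₃ := lt_of_mem_interior_triangleT (-2) (-3) (c := 0) (by norm_num) (by norm_num)
    (by norm_num) (by norm_num) h
  rw [hm, hn] at h₁ h₂ h₃
  norm_cast at h₁ h₂ h₃
  obtain rfl : m = 0 := by omega
  omega

lemma exists_three_le_abs {p q : ℤ} (h : ¬ (p = 0 ∧ q = 0)) :
    3 ≤ |2 * p + q| ∨ 3 ≤ |p - 3 * q| ∨ 3 ≤ |3 * p - 2 * q| := by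
  simp only [le_abs]
  omega

lemma abs_sub_le_width_triangleT (f : (Fin 2 → ℝ) →ₗ[ℝ] ℝ) {x y : Fin 2 → ℝ}
    (hx : x ∈ triangleT) (hy : y ∈ triangleT) :
    |f x - f y| ≤ sSup (f '' triangleT) - sInf (f '' triangleT) := by
  have hc : IsCompact (f '' triangleT) :=
    isCompact_triangleT.image f.continuous_of_finiteDimensional
  have h₁ := le_csSup hc.bddAbove (mem_image_of_mem f hx)
  have h₂ := le_csSup hc.bddAbove (mem_image_of_mem f hy)
  have h₃ := csInf_le hc.bddBelow (mem_image_of_mem f hx)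
  have h₄ := csInf_le hc.bddBelow (mem_image_of_mem f hy)
  rw [abs_le]
  constructor <;> linarith

lemma width_triangleT_ge (f : (Fin 2 → ℝ) →ₗ[ℝ] ℝ)
    (hf : ∀ v ∈ triLattice, ∃ k : ℤ, f v = (k : ℝ)) (hf₀ : f ≠ 0) :
    15 / 7 ≤ sSup (f '' triangleT) - sInf (f '' triangleT) := by
  obtain ⟨p, hp⟩ := hf ![1, 0 * Real.sqrt 3]
    ⟨1, 0, rfl, ⟨2, by norm_num⟩, ⟨0, by norm_num⟩, ⟨1, by norm_num⟩⟩
  obtain ⟨q, hq⟩ := hf ![1 / 2, 1 / 2 * Real.sqrt 3]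
    ⟨1 / 2, 1 / 2, rfl, ⟨1, by norm_num⟩, ⟨1, by norm_num⟩, ⟨1, by norm_num⟩⟩
  have hfv (a b : ℝ) : f ![a, b * Real.sqrt 3] = p * (a - b) + q * (2 * b) := by
    rw [linearMap_eq_latCoord, hp, hq, latCoordFst_apply, latCoordSnd_apply]
  have hpq : ¬ (p = 0 ∧ q = 0) := by
    rintro ⟨rfl, rfl⟩
    apply hf₀
    refine LinearMap.ext fun v => ?_
    rw [linearMap_eq_latCoord, hp, hq]
    simp
  have h₁ := vertices_subset_triangleT (mem_insert _ _)
  have h₂ := vertices_subset_triangleT (mem_insert_of_mem _ (mem_insert _ _))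
  have h₃ := vertices_subset_triangleT
    (mem_insert_of_mem _ (mem_insert_of_mem _ (mem_singleton _)))
  have key {k : ℤ} (hk : 3 ≤ |k|) {x y : Fin 2 → ℝ} (hx : x ∈ triangleT) (hy : y ∈ triangleT)
      (hxy : f x - f y = 5 / 7 * (k : ℝ)) :
      15 / 7 ≤ sSup (f '' triangleT) - sInf (f '' triangleT) := by
    refine le_trans ?_ (abs_sub_le_width_triangleT f hx hy)
    have hk' : (3 : ℝ) ≤ |(k : ℝ)| := by exact_mod_cast hk
    rw [hxy, abs_mul, abs_of_pos (by norm_num)]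
    linarith
  rcases exists_three_le_abs hpq with h | h | h
  · exact key h h₂ h₁ (by rw [hfv, hfv]; push_cast; ring)
  · exact key h h₃ h₂ (by rw [hfv, hfv]; push_cast; ring)
  · exact key h h₃ h₁ (by rw [hfv, hfv]; push_cast; ring)

lemma width_latCoordFst_triangleT :
    sSup (latCoordFst '' triangleT) - sInf (latCoordFst '' triangleT) = 15 / 7 := by
  have hmax : IsGreatest (latCoordFst '' triangleT) (9 / 7) := by
    refine ⟨⟨_, vertices_subset_triangleT
      (mem_insert_of_mem _ (mem_insert_of_mem _ (mem_singleton _))), ?_⟩, ?_⟩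
    · rw [latCoordFst_apply]; norm_num
    · rintro _ ⟨v, hv, rfl⟩
      exact le_of_mem_triangleT _ (by rw [latCoordFst_apply]; norm_num)
        (by rw [latCoordFst_apply]; norm_num) (by rw [latCoordFst_apply]; norm_num) hv
  have hmin : IsLeast (latCoordFst '' triangleT) (-6 / 7) := by
    refine ⟨⟨_, vertices_subset_triangleT (mem_insert _ _), ?_⟩, ?_⟩
    · rw [latCoordFst_apply]; norm_num
    · rintro _ ⟨v, hv, rfl⟩
      have : (-latCoordFst) v ≤ 6 / 7 := by
        refine le_of_mem_triangleT _ ?_ ?_ ?_ hv <;>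
          rw [LinearMap.neg_apply, latCoordFst_apply] <;> norm_num
      rw [LinearMap.neg_apply] at this
      linarith
  rw [hmax.csSup_eq, hmin.csInf_eq]
  norm_num

theorem triangleT_hollow_and_width :
    (∀ v ∈ triLattice, v ∉ interior triangleT) ∧
    latticeWidthIn triLattice triangleT = 15 / 7 := by
  refine ⟨fun v hv => notMem_interior_triangleT hv, IsLeast.csInf_eq ⟨?_, ?_⟩⟩
  · refine ⟨latCoordFst, fun v hv => ?_, fun h => ?_, width_latCoordFst_triangleT.symm⟩
    · obtain ⟨m, -, hm, -⟩ := exists_int_latCoord hv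
      exact ⟨m, hm⟩
    · have := latCoordFst_apply 1 0
      rw [h] at this
      norm_num at this
  · rintro _ ⟨f, hf, hf₀, rfl⟩
    exact width_triangleT_ge f hf hf₀
end

section
/- There exists a polytope P ⊆ ℝ^14 which is the convex hull of a finite subset of ℤ^14, has nonempty interior, whose interior contains no point of ℤ^14, and whose lattice width with respect to ℤ^14 equals 15. -/
open Set

/-- A nonzero functional that is at most `c` on `K` is less than `c` on the interior of `K`. -/
lemma LinearMap.lt_of_mem_interior_s4 {ι : Type*} [Finite ι] {K : Set (ι → ℝ)}
    {g : (ι → ℝ) →ₗ[ℝ] ℝ} (hg : g ≠ 0) {c : ℝ} (hK : ∀ x ∈ K, g x ≤ c) {z : ι → ℝ}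
    (hz : z ∈ interior K) : g z < c := by
  have hopen : IsOpen (g '' interior K) :=
    g.isOpenMap_of_finiteDimensional (LinearMap.surjective hg) _ isOpen_interior
  have hsub : g '' interior K ⊆ interior (Iic c) := by
    refine interior_maximal ?_ hopen
    rintro _ ⟨x, hx, rfl⟩
    exact hK x (interior_subset hx)
  rw [interior_Iic] at hsub
  exact hsub ⟨z, hz, rfl⟩

/-- An upper bound for a linear functional on a set is one on its convex hull. -/
lemma LinearMap.le_of_mem_convexHull {E : Type*} [AddCommGroup E] [Module ℝ E] {s : Set E}
    (g : E →ₗ[ℝ] ℝ) {c : ℝ} (h : ∀ x ∈ s, g x ≤ c) {x : E} (hx : x ∈ convexHull ℝ s) :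
    g x ≤ c :=
  convexHull_min (t := {y | g y ≤ c}) h (convex_halfSpace_le g.isLinear c) hx

namespace HollowPolytope

/-- The vertices of the triangle `7T`, where `T` is a hollow triangle of lattice width `15 / 7`
with the origin on its boundary. -/
def triangle : Fin 3 → Fin 2 → ℤ := ![![-9, -6], ![6, 4], ![-4, 9]]

@[simp]
lemma triangle_two : triangle 2 = ![-4, 9] := rfl

/-- The copy of the vertex `triangle j` in the `i`-th coordinate plane of `ℝ^14`. -/
noncomputable def vertex (p : Fin 7 × Fin 3) : Fin 14 → ℝ := fun k =>
  if (finProdFinEquiv.symm k : Fin 7 × Fin 2).1 = p.1 then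
    (triangle p.2 (finProdFinEquiv.symm k : Fin 7 × Fin 2).2 : ℝ) else 0

/-- The coordinate `c` in the `i`-th coordinate plane. -/
abbrev coordIndex (i : Fin 7) (c : Fin 2) : Fin 14 := finProdFinEquiv (i, c)

/-- The vertices of the direct sum of seven copies of `7T`. -/
noncomputable def vertices : Finset (Fin 14 → ℝ) := by
  classical exact Finset.univ.image vertex

lemma coe_vertices : (vertices : Set (Fin 14 → ℝ)) = range vertex := by
  simp [vertices]

lemma vertex_coordIndex (i i' : Fin 7) (j : Fin 3) (c : Fin 2) :
    vertex (i, j) (coordIndex i' c) = if i' = i then (triangle j c : ℝ) else 0 := by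
  simp [vertex, coordIndex]

lemma vertex_eq (i : Fin 7) (j : Fin 3) :
    vertex (i, j) = (triangle j 0 : ℝ) • Pi.single (coordIndex i 0) (1 : ℝ)
      + (triangle j 1 : ℝ) • Pi.single (coordIndex i 1) (1 : ℝ) := by
  funext k
  obtain ⟨⟨i', c⟩, rfl⟩ := (finProdFinEquiv (m := 7) (n := 2)).surjective k
  rw [vertex_coordIndex]
  by_cases h : i' = i <;> fin_cases c <;>
    simp [coordIndex, h]

/-- The functional with coefficients `a i c` on the `i`-th coordinate plane. -/
noncomputable def planeFunctional (a : Fin 7 → Fin 2 → ℝ) : (Fin 14 → ℝ) →ₗ[ℝ] ℝ :=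
  ∑ i, ∑ c, a i c • LinearMap.proj (coordIndex i c)

lemma planeFunctional_apply (a : Fin 7 → Fin 2 → ℝ) (x : Fin 14 → ℝ) :
    planeFunctional a x =
      ∑ i, (a i 0 * x (coordIndex i 0) + a i 1 * x (coordIndex i 1)) := by
  simp [planeFunctional, LinearMap.sum_apply]

lemma planeFunctional_vertex (a : Fin 7 → Fin 2 → ℝ) (i : Fin 7) (j : Fin 3) :
    planeFunctional a (vertex (i, j)) = a i 0 * triangle j 0 + a i 1 * triangle j 1 := by
  rw [planeFunctional_apply, Finset.sum_eq_single i]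
  · simp [vertex_coordIndex]
  · intro i' _ h
    simp [vertex_coordIndex, h]
  · simp

lemma planeFunctional_ne_zero {a : Fin 7 → Fin 2 → ℝ} {i : Fin 7} {j : Fin 3}
    (h : a i 0 * triangle j 0 + a i 1 * triangle j 1 ≠ 0) : planeFunctional a ≠ 0 := by
  intro h0
  rw [← planeFunctional_vertex, h0] at h
  exact h rfl

lemma planeFunctional_le {a : Fin 7 → Fin 2 → ℝ} {c : ℝ}
    (h : ∀ i j, a i 0 * triangle j 0 + a i 1 * triangle j 1 ≤ c) :
    ∀ x ∈ convexHull ℝ (vertices : Set (Fin 14 → ℝ)), planeFunctional a x ≤ c := by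
  intro x hx
  refine LinearMap.le_of_mem_convexHull _ ?_ hx
  rw [coe_vertices]
  rintro _ ⟨⟨i, j⟩, rfl⟩
  rw [planeFunctional_vertex]
  exact h i j

lemma vectorSpan_vertices : vectorSpan ℝ (vertices : Set (Fin 14 → ℝ)) = ⊤ := by
  rw [eq_top_iff, ← (Pi.basisFun ℝ (Fin 14)).span_eq, Submodule.span_le]
  rintro _ ⟨k, rfl⟩
  obtain ⟨⟨i, c⟩, rfl⟩ := (finProdFinEquiv (m := 7) (n := 2)).surjective k
  have hsub (j : Fin 3) : vertex (i, j) - vertex (i, 0) ∈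
      vectorSpan ℝ (vertices : Set (Fin 14 → ℝ)) :=
    vsub_mem_vectorSpan ℝ (by simp [coe_vertices]) (by simp [coe_vertices])
  have h1 := hsub 1
  have h2 := hsub 2
  simp only [vertex_eq] at h1 h2
  rw [SetLike.mem_coe, Pi.basisFun_apply]
  fin_cases c
  · convert Submodule.add_mem _ (Submodule.smul_mem _ (3 / 35 : ℝ) h1)
      (Submodule.smul_mem _ (-2 / 35 : ℝ) h2) using 1
    simp [triangle]
    module
  · convert Submodule.add_mem _ (Submodule.smul_mem _ (-1 / 35 : ℝ) h1)
      (Submodule.smul_mem _ (3 / 35 : ℝ) h2) using 1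
    simp [triangle]
    module

lemma interior_nonempty : (interior (convexHull ℝ (vertices : Set (Fin 14 → ℝ)))).Nonempty := by
  rw [interior_convexHull_nonempty_iff_affineSpan_eq_top,
    AffineSubspace.affineSpan_eq_top_iff_vectorSpan_eq_top_of_nonempty]
  · exact vectorSpan_vertices
  · exact coe_vertices ▸ range_nonempty _

lemma notMem_interior (z : Fin 14 → ℤ) :
    (fun i => (z i : ℝ)) ∉ interior (convexHull ℝ (vertices : Set (Fin 14 → ℝ))) := by
  intro hz
  by_cases hzero : ∃ i, 0 ≤ 2 * z (coordIndex i 0) - 3 * z (coordIndex i 1)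
  · obtain ⟨i, hi⟩ := hzero
    let a : Fin 7 → Fin 2 → ℝ := fun i' => if i' = i then ![2, -3] else 0
    have hne : planeFunctional a ≠ 0 :=
      planeFunctional_ne_zero (i := i) (j := 2) (by norm_num [a])
    have hle := planeFunctional_le (a := a) (c := 0) (by
      intro i' j
      by_cases h : i' = i <;> fin_cases j <;> norm_num [a, h, triangle])
    have hlt := LinearMap.lt_of_mem_interior_s4 hne hle hz
    rw [planeFunctional_apply, Finset.sum_eq_single i] at hlt
    · have hi' : (0 : ℝ) ≤ 2 * z (coordIndex i 0) - 3 * z (coordIndex i 1) := by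
        exact_mod_cast hi
      simp only [a, if_true, Matrix.cons_val_zero, Matrix.cons_val_one] at hlt
      linarith
    · intro i' _ h
      simp [a, h]
    · simp
  · push Not at hzero
    let b : Fin 7 → Prop := fun i => 2 ≤ z (coordIndex i 0) + 2 * z (coordIndex i 1)
    have hb (i : Fin 7) (h : ¬ b i) : 3 ≤ -3 * z (coordIndex i 0) + z (coordIndex i 1) := by
      have := hzero i
      simp only [b] at h
      by_contra hlt
      have hnonneg : 0 ≤ z (coordIndex i 0) := by omega
      have hnonpos : z (coordIndex i 0) ≤ 0 := by omega
      omega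
    classical
    let a : Fin 7 → Fin 2 → ℝ := fun i => if b i then ![1 / 14, 1 / 7] else ![-1 / 7, 1 / 21]
    have hvertex (i : Fin 7) : a i 0 * triangle 2 0 + a i 1 * triangle 2 1 = 1 := by
      by_cases h : b i <;> norm_num [a, h]
    have hne : planeFunctional a ≠ 0 :=
      planeFunctional_ne_zero (i := 0) (j := 2) (by rw [hvertex]; exact one_ne_zero)
    have hle := planeFunctional_le (a := a) (c := 1) (by
      intro i j
      by_cases h : b i <;> fin_cases j <;> norm_num [a, h, triangle])
    have hlt := LinearMap.lt_of_mem_interior_s4 hne hle hz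
    rw [planeFunctional_apply] at hlt
    have hge : ∑ _i : Fin 7, (1 / 7 : ℝ) ≤
        ∑ i, (a i 0 * z (coordIndex i 0) + a i 1 * z (coordIndex i 1)) := by
      refine Finset.sum_le_sum fun i _ => ?_
      by_cases h : b i
      · have h' : (2 : ℝ) ≤ z (coordIndex i 0) + 2 * z (coordIndex i 1) := by exact_mod_cast h
        simp only [a, h, if_true, Matrix.cons_val_zero, Matrix.cons_val_one]
        linarith
      · have h' : (3 : ℝ) ≤ -3 * z (coordIndex i 0) + z (coordIndex i 1) := by
          exact_mod_cast hb i h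
        simp only [a, h, if_false, Matrix.cons_val_zero, Matrix.cons_val_one]
        linarith
    norm_num at hge
    linarith

/-- Every nonzero integer functional on the plane has width at least `15` on `triangle`. -/
lemma exists_triangle_width {a b : ℤ} (h : a ≠ 0 ∨ b ≠ 0) :
    ∃ j j' : Fin 3, 15 ≤ (triangle j 0 * a + triangle j 1 * b)
      - (triangle j' 0 * a + triangle j' 1 * b) := by
  by_contra! hlt
  have h01 := hlt 0 1
  have h10 := hlt 1 0
  have h02 := hlt 0 2
  have h20 := hlt 2 0
  have h12 := hlt 1 2
  have h21 := hlt 2 1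
  simp [triangle] at h01 h10 h02 h20 h12 h21
  omega

lemma le_width {f : (Fin 14 → ℝ) →ₗ[ℝ] ℝ}
    (hint : ∀ v : Fin 14 → ℤ, ∃ k : ℤ, f (fun i => (v i : ℝ)) = (k : ℝ)) (hf : f ≠ 0) :
    15 ≤ sSup (f '' convexHull ℝ (vertices : Set (Fin 14 → ℝ)))
      - sInf (f '' convexHull ℝ (vertices : Set (Fin 14 → ℝ))) := by
  have hcoeff (k : Fin 14) : ∃ m : ℤ, f (Pi.single k 1) = m := by
    obtain ⟨m, hm⟩ := hint (Pi.single k 1)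
    refine ⟨m, hm ▸ congrArg f ?_⟩
    funext l
    by_cases h : l = k <;> simp [h]
  choose m hm using hcoeff
  obtain ⟨i, hi⟩ : ∃ i, m (coordIndex i 0) ≠ 0 ∨ m (coordIndex i 1) ≠ 0 := by
    by_contra! h
    refine hf ((Pi.basisFun ℝ (Fin 14)).ext fun k => ?_)
    obtain ⟨⟨i, c⟩, rfl⟩ := (finProdFinEquiv (m := 7) (n := 2)).surjective k
    rw [Pi.basisFun_apply, hm]
    fin_cases c
    · simpa using (h i).1
    · simpa using (h i).2
  obtain ⟨j, j', hj⟩ := exists_triangle_width hi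
  have hvertex (j : Fin 3) : f (vertex (i, j)) = ((triangle j 0 * m (coordIndex i 0)
      + triangle j 1 * m (coordIndex i 1) : ℤ) : ℝ) := by
    simp [vertex_eq, hm]
  have hmem (j : Fin 3) : f (vertex (i, j)) ∈
      f '' convexHull ℝ (vertices : Set (Fin 14 → ℝ)) :=
    mem_image_of_mem f (subset_convexHull ℝ _ (by simp [coe_vertices]))
  have hcompact : IsCompact (f '' convexHull ℝ (vertices : Set (Fin 14 → ℝ))) :=
    (vertices.finite_toSet.isCompact_convexHull ℝ).image f.continuous_of_finiteDimensional
  have hsup := le_csSup hcompact.bddAbove (hmem j)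
  have hinf := csInf_le hcompact.bddBelow (hmem j')
  have hj : (15 : ℝ) ≤ f (vertex (i, j)) - f (vertex (i, j')) := by
    rw [hvertex, hvertex]
    exact_mod_cast hj
  linarith

lemma exists_width_le : ∃ f : (Fin 14 → ℝ) →ₗ[ℝ] ℝ,
    (∀ v : Fin 14 → ℤ, ∃ k : ℤ, f (fun i => (v i : ℝ)) = (k : ℝ)) ∧ f ≠ 0 ∧
    sSup (f '' convexHull ℝ (vertices : Set (Fin 14 → ℝ)))
      - sInf (f '' convexHull ℝ (vertices : Set (Fin 14 → ℝ))) ≤ 15 := by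
  let a : Fin 7 → Fin 2 → ℝ := fun i => if i = 0 then ![1, 0] else 0
  have hcoord (x : Fin 14 → ℝ) : planeFunctional a x = x (coordIndex 0 0) := by
    rw [planeFunctional_apply, Finset.sum_eq_single 0]
    · simp [a]
    · intro i _ h
      simp [a, h]
    · simp
  refine ⟨planeFunctional a, fun v => ⟨v (coordIndex 0 0), hcoord _⟩,
    planeFunctional_ne_zero (i := 0) (j := 0) (by norm_num [a, triangle]), ?_⟩
  have hne : (planeFunctional a '' convexHull ℝ (vertices : Set (Fin 14 → ℝ))).Nonempty :=
    (convexHull_nonempty_iff.2 (coe_vertices ▸ range_nonempty _)).image _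
  have hsup : sSup (planeFunctional a '' convexHull ℝ (vertices : Set (Fin 14 → ℝ))) ≤ 6 := by
    refine csSup_le hne (forall_mem_image.2 (planeFunctional_le fun i j => ?_))
    by_cases h : i = 0 <;> fin_cases j <;> norm_num [a, h, triangle]
  have hinf : -9 ≤ sInf (planeFunctional a '' convexHull ℝ (vertices : Set (Fin 14 → ℝ))) := by
    refine le_csInf hne (forall_mem_image.2 fun x hx => ?_)
    have hneg := planeFunctional_le (a := -a) (c := 9) (fun i j => by
      by_cases h : i = 0 <;> fin_cases j <;> norm_num [a, h, triangle]) x hx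
    simp only [planeFunctional_apply, Pi.neg_apply, neg_mul, ← neg_add,
      Finset.sum_neg_distrib] at hneg
    rw [planeFunctional_apply]
    linarith
  linarith

lemma latticeWidth_eq : latticeWidth (convexHull ℝ (vertices : Set (Fin 14 → ℝ))) = 15 := by
  obtain ⟨f, hint, hf, hle⟩ := exists_width_le
  have hlower : ∀ w ∈ { w : ℝ | ∃ f : (Fin 14 → ℝ) →ₗ[ℝ] ℝ,
      (∀ v : Fin 14 → ℤ, ∃ k : ℤ, f (fun i => (v i : ℝ)) = (k : ℝ)) ∧ f ≠ 0 ∧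
      w = sSup (f '' convexHull ℝ (vertices : Set (Fin 14 → ℝ)))
        - sInf (f '' convexHull ℝ (vertices : Set (Fin 14 → ℝ))) }, 15 ≤ w := by
    rintro w ⟨g, hint, hg, rfl⟩
    exact le_width hint hg
  exact le_antisymm ((csInf_le ⟨15, hlower⟩ ⟨f, hint, hf, rfl⟩).trans hle)
    (le_csInf ⟨_, f, hint, hf, rfl⟩ hlower)

end HollowPolytope

/-- There is a hollow lattice 14-polytope of lattice width 15. -/
theorem exists_hollow_lattice_14polytope_width_15 :
    ∃ (V : Finset (Fin 14 → ℝ)) (P : Set (Fin 14 → ℝ)),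
      P = convexHull ℝ (V : Set (Fin 14 → ℝ)) ∧
      (∀ v ∈ V, ∀ i, ∃ k : ℤ, v i = (k : ℝ)) ∧
      (interior P).Nonempty ∧
      (∀ z : Fin 14 → ℤ, (fun i => (z i : ℝ)) ∉ interior P) ∧
      latticeWidth P = 15 := by
  refine ⟨HollowPolytope.vertices, _, rfl, ?_, HollowPolytope.interior_nonempty,
    HollowPolytope.notMem_interior, HollowPolytope.latticeWidth_eq⟩
  intro v hv k
  rw [← Finset.mem_coe, HollowPolytope.coe_vertices] at hv
  obtain ⟨⟨i, j⟩, rfl⟩ := hv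
  obtain ⟨⟨i', c⟩, rfl⟩ := (finProdFinEquiv (m := 7) (n := 2)).surjective k
  refine ⟨if i' = i then HollowPolytope.triangle j c else 0, ?_⟩
  rw [HollowPolytope.vertex_coordIndex]
  split_ifs <;> simp
end

section
/- There exists a simplex S ⊆ ℝ^404 which is the convex hull of 405 affinely independent points of ℤ^404, whose interior contains no point of ℤ^404, and whose lattice width with respect to ℤ^404 equals 408. -/
open Set

namespace HollowSimplex

/-! ### Linear functionals on convex hulls -/

section Hull

variable {E : Type*} [NormedAddCommGroup E] [NormedSpace ℝ E]

lemma le_of_mem_convexHull {s : Set E} {f : E →ₗ[ℝ] ℝ} {c : ℝ} (h : ∀ x ∈ s, f x ≤ c)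
    {x : E} (hx : x ∈ convexHull ℝ s) : f x ≤ c :=
  convexHull_min (t := {y | f y ≤ c}) h (convex_halfSpace_le f.isLinear c) hx

lemma ge_of_mem_convexHull {s : Set E} {f : E →ₗ[ℝ] ℝ} {c : ℝ} (h : ∀ x ∈ s, c ≤ f x)
    {x : E} (hx : x ∈ convexHull ℝ s) : c ≤ f x :=
  convexHull_min (t := {y | c ≤ f y}) h (convex_halfSpace_ge f.isLinear c) hx

/-- A nonzero linear functional does not attain its upper bounds at interior points. -/
lemma lt_of_mem_interior [FiniteDimensional ℝ E] {K : Set E} {f : E →ₗ[ℝ] ℝ} (hf : f ≠ 0)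
    {c : ℝ} (h : ∀ x ∈ K, f x ≤ c) {x : E} (hx : x ∈ interior K) : f x < c := by
  have hopen : IsOpenMap f :=
    f.isOpenMap_of_finiteDimensional (LinearMap.surjective hf)
  have hsub : f '' interior K ⊆ interior (Iic c) :=
    interior_maximal (by rintro _ ⟨y, hy, rfl⟩; exact h y (interior_subset hy))
      (hopen _ isOpen_interior)
  rw [interior_Iic] at hsub
  exact hsub ⟨x, hx, rfl⟩

lemma sub_le_sSup_sub_sInf [FiniteDimensional ℝ E] {K : Set E} (hK : IsCompact K)
    (f : E →ₗ[ℝ] ℝ) {x y : E} (hx : x ∈ K) (hy : y ∈ K) :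
    f x - f y ≤ sSup (f '' K) - sInf (f '' K) := by
  have hc : IsCompact (f '' K) := hK.image f.continuous_of_finiteDimensional
  exact sub_le_sub (le_csSup hc.bddAbove ⟨x, hx, rfl⟩) (csInf_le hc.bddBelow ⟨y, hy, rfl⟩)

end Hull

/-! ### The empty lattice 4-simplex of width four and normalized volume 101 -/

/-- The vertices other than the origin of the empty 4-simplex of Haase and Ziegler, as rows. -/
def emptyVertex : Fin 4 → Fin 4 → ℤ :=
  ![![1, 0, 0, 0], ![0, 1, 0, 0], ![0, 0, 1, 0], ![6, 14, 17, 101]]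

/-- The barycentric coordinates of the empty simplex, multiplied by 101. -/
def emptyDual : Fin 4 → Fin 4 → ℤ :=
  ![![101, 0, 0, -6], ![0, 101, 0, -14], ![0, 0, 101, -17], ![0, 0, 0, 1]]

lemma sum_emptyDual_mul_emptyVertex (a b : Fin 4) :
    ∑ k, emptyDual a k * emptyVertex b k = if a = b then 101 else 0 := by
  revert a b; decide

/-- A lattice point in the interior of the cone over the empty simplex lies beyond the facet
opposite to the origin. -/
lemma lt_sum_emptyDual (z : Fin 4 → ℤ) (hz : ∀ a, 0 < ∑ k, emptyDual a k * z k) :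
    102 ≤ ∑ a, ∑ k, emptyDual a k * z k := by
  have h0 := hz 0
  have h1 := hz 1
  have h2 := hz 2
  have h3 := hz 3
  simp [emptyDual, Fin.sum_univ_four] at h0 h1 h2 h3 ⊢
  by_contra! hlt
  have hz3 : z 3 < 101 := by linarith
  generalize z 0 = x at *
  generalize z 1 = y at *
  generalize z 2 = w at *
  generalize z 3 = t at *
  interval_cases t <;> omega

/-- An integer functional of width less than four on the empty simplex vanishes. -/
lemma eq_zero_of_width_lt_four (a : Fin 4 → ℤ)
    (hle : ∀ b, |∑ k, emptyVertex b k * a k| < 4)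
    (hsub : ∀ b c, (∑ k, emptyVertex b k * a k) - ∑ k, emptyVertex c k * a k < 4) :
    a = 0 := by
  have h0 := hle 0
  have h1 := hle 1
  have h2 := hle 2
  have h3 := hle 3
  have h01 := hsub 0 1
  have h02 := hsub 0 2
  have h03 := hsub 0 3
  have h10 := hsub 1 0
  have h12 := hsub 1 2
  have h13 := hsub 1 3
  have h20 := hsub 2 0
  have h21 := hsub 2 1
  have h23 := hsub 2 3
  have h30 := hsub 3 0
  have h31 := hsub 3 1
  have h32 := hsub 3 2
  clear hle hsub
  simp [emptyVertex, Fin.sum_univ_four, abs_lt] at *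
  suffices a 0 = 0 ∧ a 1 = 0 ∧ a 2 = 0 ∧ a 3 = 0 by
    ext k; fin_cases k <;> simp [this]
  generalize a 0 = x at *
  generalize a 1 = y at *
  generalize a 2 = z at *
  generalize a 3 = t at *
  obtain ⟨_, _⟩ := h0
  obtain ⟨_, _⟩ := h1
  obtain ⟨_, _⟩ := h2
  interval_cases x <;> interval_cases y <;> first | omega | (interval_cases z <;> omega)

/-! ### The 404-dimensional simplex -/

/-- Coordinates of `ℝ^404` grouped into 101 blocks of four. -/
def blockEquiv : Fin 101 × Fin 4 ≃ Fin 404 := finProdFinEquiv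

/-- The functional on `ℝ^404` that evaluates `a` on the block `i`. -/
noncomputable def blockForm (i : Fin 101) (a : Fin 4 → ℤ) : (Fin 404 → ℝ) →ₗ[ℝ] ℝ :=
  ∑ k, (a k : ℝ) • LinearMap.proj (blockEquiv (i, k))

lemma blockForm_apply (i : Fin 101) (a : Fin 4 → ℤ) (x : Fin 404 → ℝ) :
    blockForm i a x = ∑ k, (a k : ℝ) * x (blockEquiv (i, k)) := by
  simp [blockForm]

lemma blockForm_intCast (i : Fin 101) (a : Fin 4 → ℤ) (z : Fin 404 → ℤ) :
    blockForm i a (fun j => (z j : ℝ)) = ((∑ k, a k * z (blockEquiv (i, k)) : ℤ) : ℝ) := by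
  simp [blockForm_apply]

/-- The vertex `b` of 102 times the empty simplex, placed in the block `i`. -/
noncomputable def blockVertex (i : Fin 101) (b : Fin 4) : Fin 404 → ℝ :=
  ∑ k, (102 * emptyVertex b k : ℝ) • Pi.single (blockEquiv (i, k)) 1

/-- The vertices of the simplex. -/
noncomputable def vertex : Fin 405 → Fin 404 → ℝ :=
  Fin.cons 0 fun j => blockVertex (blockEquiv.symm j).1 (blockEquiv.symm j).2

lemma vertex_zero : vertex 0 = 0 := rfl

lemma vertex_succ (j : Fin 404) :
    vertex j.succ = blockVertex (blockEquiv.symm j).1 (blockEquiv.symm j).2 := rfl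

lemma forall_range_vertex {p : (Fin 404 → ℝ) → Prop} :
    (∀ x ∈ range vertex, p x) ↔ p 0 ∧ ∀ i b, p (blockVertex i b) := by
  rw [forall_mem_range, Fin.forall_fin_succ, vertex_zero]
  simp only [vertex_succ, ← Prod.forall', blockEquiv.symm.forall_congr_left]
  simp

lemma zero_mem_range_vertex : (0 : Fin 404 → ℝ) ∈ range vertex := ⟨0, vertex_zero⟩

lemma blockVertex_mem_range_vertex (i : Fin 101) (b : Fin 4) :
    blockVertex i b ∈ range vertex :=
  ⟨(blockEquiv (i, b)).succ, by simp [vertex_succ]⟩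

lemma blockVertex_eq_intCast (i : Fin 101) (b : Fin 4) (j : Fin 404) :
    ∃ k : ℤ, blockVertex i b j = k :=
  ⟨∑ k, 102 * emptyVertex b k * (Pi.single (blockEquiv (i, k)) 1 : Fin 404 → ℤ) j, by
    simp [blockVertex, Pi.single_apply]⟩

lemma blockForm_blockVertex (i i' : Fin 101) (a : Fin 4 → ℤ) (b : Fin 4) :
    blockForm i a (blockVertex i' b) =
      if i = i' then 102 * ((∑ k, a k * emptyVertex b k : ℤ) : ℝ) else 0 := by
  simp only [blockForm_apply, blockVertex, Finset.sum_apply, Pi.smul_apply, Pi.single_apply,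
    EmbeddingLike.apply_eq_iff_eq, Prod.mk.injEq, smul_eq_mul]
  split_ifs with h
  · simp [h, Finset.mul_sum, mul_left_comm]
  · simp [h]

lemma blockForm_emptyDual_blockVertex (i i' : Fin 101) (a b : Fin 4) :
    blockForm i (emptyDual a) (blockVertex i' b) =
      if i = i' ∧ a = b then 102 * 101 else 0 := by
  rw [blockForm_blockVertex, sum_emptyDual_mul_emptyVertex]
  split_ifs <;> simp_all

lemma affineIndependent_vertex : AffineIndependent ℝ vertex := by
  rw [affineIndependent_iff_linearIndependent_vsub ℝ _ (0 : Fin 405)]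
  rw [← linearIndependent_equiv (finSuccAboveEquiv (0 : Fin 405)), Fintype.linearIndependent_iff]
  intro g hg j
  have h := congrArg
    (blockForm (blockEquiv.symm j).1 (emptyDual (blockEquiv.symm j).2)) hg
  simpa [vertex_zero, vertex_succ, blockForm_emptyDual_blockVertex, finSuccAboveEquiv_apply,
    ← Prod.ext_iff] using h

lemma vertex_eq_intCast (j : Fin 405) (i : Fin 404) : ∃ k : ℤ, vertex j i = (k : ℝ) := by
  have h : ∀ x ∈ range vertex, ∀ i, ∃ k : ℤ, x i = (k : ℝ) :=
    forall_range_vertex.2 ⟨fun _ => ⟨0, by simp⟩, blockVertex_eq_intCast⟩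
  exact h _ ⟨j, rfl⟩ i

lemma hollow_vertex (z : Fin 404 → ℤ) :
    (fun i => (z i : ℝ)) ∉ interior (convexHull ℝ (range vertex)) := by
  intro hz
  have hpos (i a) : 0 < ∑ k, emptyDual a k * z (blockEquiv (i, k)) := by
    have hv := blockForm_emptyDual_blockVertex i i a a
    have hne : -blockForm i (emptyDual a) ≠ 0 := by
      intro h
      have := LinearMap.congr_fun h (blockVertex i a)
      simp [hv] at this
    have hb : ∀ x ∈ range vertex, (-blockForm i (emptyDual a)) x ≤ 0 := by
      rw [forall_range_vertex]
      refine ⟨by simp, fun i' b => ?_⟩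
      rw [LinearMap.neg_apply, blockForm_emptyDual_blockVertex]
      split_ifs <;> norm_num
    have := lt_of_mem_interior hne (fun x hx => le_of_mem_convexHull hb hx) hz
    rw [LinearMap.neg_apply, blockForm_intCast, neg_lt_zero] at this
    exact_mod_cast this
  let T : (Fin 404 → ℝ) →ₗ[ℝ] ℝ := ∑ i, ∑ a, blockForm i (emptyDual a)
  have hT (i b) : T (blockVertex i b) = 102 * 101 := by
    simp [T, blockForm_emptyDual_blockVertex, ite_and]
  have hne : T ≠ 0 := by
    intro h
    have := hT 0 0
    simp [h] at this
  have hb : ∀ x ∈ range vertex, T x ≤ 102 * 101 :=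
    forall_range_vertex.2 ⟨by simp, fun i b => (hT i b).le⟩
  have hlt := lt_of_mem_interior hne (fun x hx => le_of_mem_convexHull hb hx) hz
  have hTz : T (fun i => (z i : ℝ)) =
      ((∑ i, ∑ a, ∑ k, emptyDual a k * z (blockEquiv (i, k)) : ℤ) : ℝ) := by
    simp only [T, LinearMap.sum_apply, blockForm_intCast, Int.cast_sum]
  rw [hTz] at hlt
  have hlt' : ∑ i, ∑ a, ∑ k, emptyDual a k * z (blockEquiv (i, k)) < 102 * 101 := by
    exact_mod_cast hlt
  have hge := Finset.sum_le_sum fun i (_ : i ∈ Finset.univ) =>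
    lt_sum_emptyDual (fun k => z (blockEquiv (i, k))) (hpos i)
  simp only [Finset.sum_const, Finset.card_univ, Fintype.card_fin] at hge
  norm_num at hge hlt'
  exact absurd hlt' hge.not_gt

lemma isCompact_convexHull_vertex : IsCompact (convexHull ℝ (range vertex)) :=
  (finite_range vertex).isCompact_convexHull ℝ

lemma le_width (f : (Fin 404 → ℝ) →ₗ[ℝ] ℝ)
    (hf : ∀ v : Fin 404 → ℤ, ∃ k : ℤ, f (fun i => (v i : ℝ)) = (k : ℝ)) (hne : f ≠ 0) :
    408 ≤ sSup (f '' convexHull ℝ (range vertex)) - sInf (f '' convexHull ℝ (range vertex)) := by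
  by_contra! hlt
  have hsub {x y} (hx : x ∈ range vertex) (hy : y ∈ range vertex) : f x - f y < 408 :=
    (sub_le_sSup_sub_sInf isCompact_convexHull_vertex f (subset_convexHull ℝ _ hx)
      (subset_convexHull ℝ _ hy)).trans_lt hlt
  have hint (j : Fin 404) : ∃ k : ℤ, f (Pi.single j 1) = k := by
    obtain ⟨k, hk⟩ := hf (Pi.single j 1)
    refine ⟨k, hk ▸ congrArg f ?_⟩
    ext i
    simp [Pi.single_apply]
  choose a ha using hint
  have hv (i b) : f (blockVertex i b) =
      ((102 * ∑ k, emptyVertex b k * a (blockEquiv (i, k)) : ℤ) : ℝ) := by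
    simp [blockVertex, ha, Finset.mul_sum, mul_assoc]
  have hzero (i : Fin 101) : (fun k => a (blockEquiv (i, k))) = 0 := by
    apply eq_zero_of_width_lt_four
    · intro b
      have h1 := hsub (blockVertex_mem_range_vertex i b) zero_mem_range_vertex
      have h2 := hsub zero_mem_range_vertex (blockVertex_mem_range_vertex i b)
      rw [map_zero, sub_zero, hv] at h1
      rw [map_zero, zero_sub, hv] at h2
      norm_cast at h1 h2
      rw [abs_lt]
      omega
    · intro b c
      have h := hsub (blockVertex_mem_range_vertex i b) (blockVertex_mem_range_vertex i c)
      rw [hv, hv] at h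
      norm_cast at h
      omega
  apply hne
  refine LinearMap.pi_ext' fun j => LinearMap.ext_ring ?_
  have := congrFun (hzero (blockEquiv.symm j).1) (blockEquiv.symm j).2
  simp at this
  simp [ha, this]

lemma exists_width_le : ∃ f : (Fin 404 → ℝ) →ₗ[ℝ] ℝ,
    (∀ v : Fin 404 → ℤ, ∃ k : ℤ, f (fun i => (v i : ℝ)) = (k : ℝ)) ∧ f ≠ 0 ∧
    sSup (f '' convexHull ℝ (range vertex)) - sInf (f '' convexHull ℝ (range vertex)) ≤ 408 := by
  set f := blockForm 0 ![2, -1, 0, 0] with hf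
  have hle : ∀ b, |∑ k, (![2, -1, 0, 0] : Fin 4 → ℤ) k * emptyVertex b k| ≤ 2 := by decide
  have hv (i b) : |f (blockVertex i b)| ≤ 204 := by
    rw [hf, blockForm_blockVertex]
    split_ifs
    · rw [abs_mul, ← Int.cast_abs]
      have : ((|∑ k, (![2, -1, 0, 0] : Fin 4 → ℤ) k * emptyVertex b k| : ℤ) : ℝ) ≤ 2 := by
        exact_mod_cast hle b
      norm_num at this ⊢
      linarith
    · norm_num
  have hne : (f '' convexHull ℝ (range vertex)).Nonempty :=
    ⟨_, 0, subset_convexHull ℝ _ zero_mem_range_vertex, rfl⟩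
  have hsup : sSup (f '' convexHull ℝ (range vertex)) ≤ 204 := by
    refine csSup_le hne (forall_mem_image.2 fun x hx => le_of_mem_convexHull ?_ hx)
    exact forall_range_vertex.2 ⟨by simp, fun i b => (abs_le.1 (hv i b)).2⟩
  have hinf : -204 ≤ sInf (f '' convexHull ℝ (range vertex)) := by
    refine le_csInf hne (forall_mem_image.2 fun x hx => ge_of_mem_convexHull ?_ hx)
    exact forall_range_vertex.2 ⟨by simp, fun i b => (abs_le.1 (hv i b)).1⟩
  refine ⟨f, fun v => ⟨_, blockForm_intCast _ _ v⟩, fun h => ?_, by linarith⟩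
  have := blockForm_blockVertex 0 0 ![2, -1, 0, 0] 0
  have hsum : ∑ k, (![2, -1, 0, 0] : Fin 4 → ℤ) k * emptyVertex 0 k = 2 := by decide
  rw [← hf, h, hsum] at this
  norm_num at this

lemma latticeWidth_vertex : latticeWidth (convexHull ℝ (range vertex)) = 408 := by
  refine IsLeast.csInf_eq ⟨?_, ?_⟩
  · obtain ⟨f, hf, hne, hle⟩ := exists_width_le
    exact ⟨f, hf, hne, (le_width f hf hne).antisymm hle⟩
  · rintro _ ⟨f, hf, hne, rfl⟩
    exact le_width f hf hne

end HollowSimplex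

/-- There is a hollow lattice 404-simplex of lattice width 408. -/
theorem exists_hollow_lattice_404simplex_width_408 :
    ∃ v : Fin 405 → (Fin 404 → ℝ),
      AffineIndependent ℝ v ∧
      (∀ j i, ∃ k : ℤ, v j i = (k : ℝ)) ∧
      (∀ z : Fin 404 → ℤ,
        (fun i => (z i : ℝ)) ∉ interior (convexHull ℝ (Set.range v))) ∧
      latticeWidth (convexHull ℝ (Set.range v)) = 408 :=
  ⟨HollowSimplex.vertex, HollowSimplex.affineIndependent_vertex, HollowSimplex.vertex_eq_intCast,
    HollowSimplex.hollow_vertex, HollowSimplex.latticeWidth_vertex⟩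
end

section
/- There exists a tetrahedron Δ ⊆ ℝ³ (the convex hull of 4 affinely independent points) whose interior contains no point of ℤ³ and whose lattice width with respect to ℤ³ equals 2 + √2. -/
open Set

namespace HollowTetrahedron

/-- The constant such that each coordinate takes exactly the values in `[-3c, 1 + c]` on the
tetrahedron. -/
noncomputable def c : ℝ := (1 + Real.sqrt 2) / 4

/-- The vertices of the tetrahedron. In barycentric coordinates with respect to
`0, e₁, e₂, e₃` they are the cyclic shifts of `(-3c, c, c, 1 + c)`. -/
noncomputable def vertex : Fin 4 → Fin 3 → ℝ :=
  ![![c, c, 1 + c], ![-3 * c, c, c], ![1 + c, -3 * c, c], ![c, 1 + c, -3 * c]]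

lemma sqrt_two_bounds : 1.41 < Real.sqrt 2 ∧ Real.sqrt 2 < 1.42 :=
  ⟨Real.lt_sqrt_of_sq_lt (by norm_num), (Real.sqrt_lt' (by norm_num)).2 (by norm_num)⟩

lemma sqrt_two_mul_self : Real.sqrt 2 * Real.sqrt 2 = 2 :=
  Real.mul_self_sqrt (by norm_num)

lemma affineIndependent_vertex : AffineIndependent ℝ vertex := by
  rw [affineIndependent_iff_of_fintype]
  intro w hw h
  rw [Finset.univ.weightedVSub_eq_linear_combination hw] at h
  have h0 := congrFun h 0
  have h1 := congrFun h 1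
  have h2 := congrFun h 2
  simp [Fin.sum_univ_four, vertex] at hw h0 h1 h2
  have hc : 0 < c := by unfold c; positivity
  have e2 : w 2 = 4 * c * w 1 := by linear_combination h0 - c * hw
  have e3 : w 3 = 4 * c * w 2 := by linear_combination h1 - c * hw
  have e0 : w 0 = 4 * c * w 3 := by linear_combination h2 - c * hw
  have hmul : w 1 * (1 + 4 * c + (4 * c) ^ 2 + (4 * c) ^ 3) = 0 := by
    rw [e0, e3, e2] at hw
    linear_combination hw
  have w1 : w 1 = 0 := (mul_eq_zero.1 hmul).resolve_right (by positivity)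
  have w2 : w 2 = 0 := by rw [e2, w1, mul_zero]
  have w3 : w 3 = 0 := by rw [e3, w2, mul_zero]
  have w0 : w 0 = 0 := by rw [e0, w3, mul_zero]
  intro i
  fin_cases i <;> assumption

/-- A nonzero functional with a lower bound on a set is strictly above that bound on the
interior. -/
lemma lt_of_mem_interior {E : Type*} [NormedAddCommGroup E] [NormedSpace ℝ E]
    [FiniteDimensional ℝ E] {K : Set E} {f : E →ₗ[ℝ] ℝ} (hf : f ≠ 0) {m : ℝ}
    (h : ∀ y ∈ K, m ≤ f y) {x : E} (hx : x ∈ interior K) : m < f x := by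
  have ho : IsOpenMap f := f.isOpenMap_of_finiteDimensional (LinearMap.surjective hf)
  have hsub : f '' interior K ⊆ Ici m := by
    rintro _ ⟨y, hy, rfl⟩
    exact h y (interior_subset hy)
  have := interior_maximal hsub (ho _ isOpen_interior) (mem_image_of_mem f hx)
  rwa [interior_Ici] at this

lemma le_of_mem_convexHull_range {E ι : Type*} [AddCommGroup E] [Module ℝ E] {v : ι → E}
    {f : E →ₗ[ℝ] ℝ} {m : ℝ} (h : ∀ i, m ≤ f (v i)) {x : E}
    (hx : x ∈ convexHull ℝ (range v)) : m ≤ f x :=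
  convexHull_min (t := {y | m ≤ f y}) (range_subset_iff.2 h)
    (convex_halfSpace_ge f.isLinear m) hx

/-- The functional on `ℝ³` with prescribed coefficients. -/
noncomputable def functional (a : Fin 3 → ℝ) : (Fin 3 → ℝ) →ₗ[ℝ] ℝ :=
  Fintype.linearCombination ℝ a

lemma functional_apply (a x : Fin 3 → ℝ) :
    functional a x = a 0 * x 0 + a 1 * x 1 + a 2 * x 2 := by
  simp [functional, Fintype.linearCombination_apply, Fin.sum_univ_three]
  ring

lemma facet_lt {a : Fin 3 → ℝ} {m : ℝ} (ha : a 0 ≠ a 1 ∨ a 1 ≠ a 2)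
    (h : ∀ i, m ≤ functional a (vertex i)) {x : Fin 3 → ℝ}
    (hx : x ∈ interior (convexHull ℝ (range vertex))) : m < a 0 * x 0 + a 1 * x 1 + a 2 * x 2 := by
  rw [← functional_apply]
  refine lt_of_mem_interior (fun h0 => ?_) (fun y hy => le_of_mem_convexHull_range h hy) hx
  have e0 := LinearMap.congr_fun h0 ![1, 0, 0]
  have e1 := LinearMap.congr_fun h0 ![0, 1, 0]
  have e2 := LinearMap.congr_fun h0 ![0, 0, 1]
  simp [functional_apply] at e0 e1 e2
  simp [e0, e1, e2] at ha

lemma hollow (z : Fin 3 → ℤ) :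
    (fun i => (z i : ℝ)) ∉ interior (convexHull ℝ (range vertex)) := by
  intro hz
  obtain ⟨hl, hu⟩ := sqrt_two_bounds
  have hs := sqrt_two_mul_self
  have L0 := facet_lt (a := ![1, √2, 3 - √2]) (m := 0)
    (by left; simp only [Matrix.cons_val]; linarith)
    (fun i => by
      fin_cases i <;> simp [functional_apply, vertex, c] <;> nlinarith) hz
  have L1 := facet_lt (a := ![-(3 - √2), 1 - (3 - √2), √2 - (3 - √2)]) (m := -(3 - √2))
    (by left; simp only [Matrix.cons_val]; linarith)
    (fun i => by
      fin_cases i <;> simp [functional_apply, vertex, c] <;> nlinarith) hz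
  have L2 := facet_lt (a := ![3 - √2 - √2, -√2, 1 - √2]) (m := -√2)
    (by right; simp only [Matrix.cons_val]; linarith)
    (fun i => by
      fin_cases i <;> simp [functional_apply, vertex, c] <;> nlinarith) hz
  have L3 := facet_lt (a := ![√2 - 1, 3 - √2 - 1, -1]) (m := -1)
    (by right; simp only [Matrix.cons_val]; linarith)
    (fun i => by
      fin_cases i <;> simp [functional_apply, vertex, c] <;> nlinarith) hz
  simp only [Matrix.cons_val] at L0 L1 L2 L3
  generalize z 0 = x at *
  generalize z 1 = y at *
  generalize z 2 = t at *
  have bound : ∀ (n : ℤ) (l l' : ℝ), 0 < l → 0 < l' → l + l' < 4 →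
      4 * (n : ℝ) = 1 + √2 - (1 + √2) * l + l' → -1 ≤ n ∧ n ≤ 1 := by
    intro n l l' h h' h4 hn
    have hn1 : (n : ℝ) < 2 := by nlinarith
    have hn2 : (-2 : ℝ) < n := by nlinarith
    have hn1' : n < 2 := by exact_mod_cast hn1
    have hn2' : -2 < n := by exact_mod_cast hn2
    omega
  obtain ⟨hx, hx'⟩ := bound x _ _ (sub_pos.2 L1) (sub_pos.2 L2) (by linarith)
    (by linear_combination (-1 + x + y + 2 * t) * hs)
  obtain ⟨hy, hy'⟩ := bound y _ _ (sub_pos.2 L2) (sub_pos.2 L3) (by linarith)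
    (by linear_combination (1 - y - 2 * x - t) * hs)
  obtain ⟨ht, ht'⟩ := bound t _ _ (sub_pos.2 L3) (sub_pos.2 L0) (by linarith)
    (by linear_combination (x - y) * hs)
  clear bound
  interval_cases x <;> interval_cases y <;> interval_cases t <;> push_cast at * <;> linarith

/-- Going around a cycle, some minimum of a nonconstant function follows a larger value. -/
lemma exists_min_lt_sub_one {a : Fin 4 → ℤ} (ha : ∃ i, a i ≠ a 0) :
    ∃ i, (∀ k, a i ≤ a k) ∧ a i < a (i - 1) := by
  obtain ⟨m, hm⟩ := Finite.exists_min a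
  by_contra! h
  have step (i : Fin 4) (hi : a i = a m) : a (i - 1) = a m :=
    le_antisymm (hi ▸ h i fun k => hi ▸ hm k) (hm _)
  have h1 := step m rfl
  have h2 := step _ h1
  have h3 := step _ h2
  have hall (k : Fin 4) : a k = a m := by
    have : k = m ∨ k = m - 1 ∨ k = m - 1 - 1 ∨ k = m - 1 - 1 - 1 := by
      clear * -
      revert k m
      decide
    rcases this with rfl | rfl | rfl | rfl <;> first | rfl | assumption
  obtain ⟨i, hi⟩ := ha
  exact hi ((hall i).trans (hall 0).symm)

lemma exists_diff_ge {s : ℝ} (hs : 1 ≤ s) {a : Fin 4 → ℤ} (ha : ∃ i, a i ≠ a 0) :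
    ∃ i j, 1 + s ≤ (a (i - 1) - s * a i) - (a (j - 1) - s * a j) := by
  obtain ⟨i, hi, hi'⟩ := exists_min_lt_sub_one ha
  obtain ⟨j, hj, hj'⟩ := exists_min_lt_sub_one (a := -a) (by simpa using ha)
  simp only [Pi.neg_apply, neg_le_neg_iff, neg_lt_neg_iff] at hj hj'
  refine ⟨i, j, ?_⟩
  have h1 : (a i : ℝ) + 1 ≤ a (i - 1) := by exact_mod_cast hi'
  have h2 : (a (j - 1) : ℝ) + 1 ≤ a j := by exact_mod_cast hj'
  have h3 : (a i : ℝ) + 1 ≤ a j := by exact_mod_cast hi'.trans_le (hj _)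
  nlinarith

lemma le_width_of_mem {E ι : Type*} [Finite ι] [NormedAddCommGroup E] [NormedSpace ℝ E]
    [FiniteDimensional ℝ E] (v : ι → E) (f : E →ₗ[ℝ] ℝ) {x y : E}
    (hx : x ∈ convexHull ℝ (range v)) (hy : y ∈ convexHull ℝ (range v)) :
    f x - f y ≤ sSup (f '' convexHull ℝ (range v)) - sInf (f '' convexHull ℝ (range v)) := by
  have hc : IsCompact (f '' convexHull ℝ (range v)) :=
    (finite_range v).isCompact_convexHull ℝ |>.image f.continuous_of_finiteDimensional
  exact sub_le_sub (le_csSup hc.bddAbove (mem_image_of_mem f hx))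
    (csInf_le hc.bddBelow (mem_image_of_mem f hy))

lemma le_width {f : (Fin 3 → ℝ) →ₗ[ℝ] ℝ}
    (hf : ∀ v : Fin 3 → ℤ, ∃ k : ℤ, f (fun i => (v i : ℝ)) = (k : ℝ)) (h0 : f ≠ 0) :
    2 + √2 ≤ sSup (f '' convexHull ℝ (range vertex)) -
      sInf (f '' convexHull ℝ (range vertex)) := by
  have hk (i : Fin 3) : ∃ k : ℤ, f (Pi.single i 1) = k := by
    obtain ⟨k, hk⟩ := hf (Pi.single i 1)
    refine ⟨k, hk ▸ congrArg f ?_⟩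
    ext j
    by_cases h : j = i <;> simp [h]
  choose k hk using hk
  have hfx (x : Fin 3 → ℝ) : f x = k 0 * x 0 + k 1 * x 1 + k 2 * x 2 := by
    rw [LinearMap.pi_apply_eq_sum_univ f x, Fin.sum_univ_three]
    have (i : Fin 3) : (fun j => if i = j then (1 : ℝ) else 0) = Pi.single i 1 := by
      ext j
      simp [Pi.single_apply, eq_comm]
    simp only [this, hk, smul_eq_mul]
    ring
  obtain ⟨i, j, hij⟩ := exists_diff_ge (s := 1 + √2) (by simp)
    (a := ![0, k 0, k 1, k 2]) (by
      by_contra! h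
      have e0 : k 0 = 0 := h 1
      have e1 : k 1 = 0 := h 2
      have e2 : k 2 = 0 := h 3
      exact h0 (LinearMap.ext fun x => by simp [hfx, e0, e1, e2]))
  have hv (i : Fin 4) : f (vertex i) = c * (k 0 + k 1 + k 2) +
      ((![0, k 0, k 1, k 2] (i - 1) : ℤ) - (1 + √2) * (![0, k 0, k 1, k 2] i : ℤ)) := by
    rw [hfx]
    fin_cases i <;> simp [vertex, c] <;> ring
  have hmem (i : Fin 4) : vertex i ∈ convexHull ℝ (range vertex) :=
    subset_convexHull ℝ _ (mem_range_self i)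
  have := le_width_of_mem vertex f (hmem i) (hmem j)
  rw [hv, hv] at this
  linarith

lemma width_first_coordinate :
    2 + √2 = sSup (LinearMap.proj (R := ℝ) (φ := fun _ : Fin 3 => ℝ) 0 ''
        convexHull ℝ (range vertex)) -
      sInf (LinearMap.proj (R := ℝ) (φ := fun _ : Fin 3 => ℝ) 0 ''
        convexHull ℝ (range vertex)) := by
  have hc : 0 < c := by unfold c; positivity
  have hmem (i : Fin 4) : vertex i ∈ convexHull ℝ (range vertex) :=
    subset_convexHull ℝ _ (mem_range_self i)
  have hmax : IsGreatest (LinearMap.proj (R := ℝ) (φ := fun _ : Fin 3 => ℝ) 0 ''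
      convexHull ℝ (range vertex)) (1 + c) := by
    refine ⟨⟨vertex 2, hmem 2, by simp [vertex]⟩, ?_⟩
    rintro _ ⟨x, hx, rfl⟩
    have := le_of_mem_convexHull_range (f := -LinearMap.proj (R := ℝ) (φ := fun _ : Fin 3 => ℝ) 0)
      (m := -(1 + c)) (fun i => by fin_cases i <;> simp [vertex] <;> linarith) hx
    exact neg_le_neg_iff.1 this
  have hmin : IsLeast (LinearMap.proj (R := ℝ) (φ := fun _ : Fin 3 => ℝ) 0 ''
      convexHull ℝ (range vertex)) (-3 * c) := by
    refine ⟨⟨vertex 1, hmem 1, by simp [vertex]⟩, ?_⟩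
    rintro _ ⟨x, hx, rfl⟩
    exact le_of_mem_convexHull_range
      (fun i => by fin_cases i <;> simp [vertex] <;> linarith) hx
  rw [hmax.csSup_eq, hmin.csInf_eq, c]
  ring

end HollowTetrahedron

open HollowTetrahedron in
/-- There is a hollow tetrahedron in `ℝ³` of lattice width `2 + √2`. -/
theorem exists_hollow_tetrahedron_width_two_add_sqrt_two :
    ∃ v : Fin 4 → (Fin 3 → ℝ),
      AffineIndependent ℝ v ∧
      (∀ z : Fin 3 → ℤ,
        (fun i => (z i : ℝ)) ∉ interior (convexHull ℝ (Set.range v))) ∧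
      latticeWidth (convexHull ℝ (Set.range v)) = 2 + Real.sqrt 2 := by
  refine ⟨vertex, affineIndependent_vertex, hollow, ?_⟩
  refine IsLeast.csInf_eq ⟨⟨LinearMap.proj 0, fun v => ⟨v 0, rfl⟩, fun h => ?_,
    width_first_coordinate⟩, ?_⟩
  · simpa using LinearMap.congr_fun h 1
  · rintro _ ⟨f, hf, h0, rfl⟩
    exact le_width hf h0
end

section
/- Let (x, y, z) ∈ ℝ³ satisfy x² + y² − 2x − 2y ≠ 0 and z = (x² + y²)/(x² + y² − 2x − 2y), and let Δ(x,y,z) ⊆ ℝ³ be the tetrahedron with vertices (x, y, z), (−y, x, −z), (−x, −y, z) and (y, −x, −z). Then the lattice width of Δ(x,y,z) with respect to Λ is at most 2 + √2, and it equals 2 + √2 if and only if (x, y, z) = (2 + √2, √2, 2 + √2) or (x, y, z) = (√2, 2 + √2, 2 + √2). -/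
open Set

/-- The (dilated) face-centered cubic lattice
`Λ = {(a,b,c) : a,b,c ∈ 2ℤ, a+b+c ∈ 4ℤ}`. -/
def fccLattice : Set (Fin 3 → ℝ) :=
  { p | (∃ a : ℤ, p 0 = 2 * (a : ℝ)) ∧ (∃ b : ℤ, p 1 = 2 * (b : ℝ)) ∧
        (∃ c : ℤ, p 2 = 2 * (c : ℝ)) ∧ (∃ k : ℤ, p 0 + p 1 + p 2 = 4 * (k : ℝ)) }

/-- The tetrahedron `Δ(x,y,z)` with vertices `(x,y,z)`, `(−y,x,−z)`, `(−x,−y,z)`,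
`(y,−x,−z)`. -/
def Delta (x y z : ℝ) : Set (Fin 3 → ℝ) :=
  convexHull ℝ {![x, y, z], ![-y, x, -z], ![-x, -y, z], ![y, -x, -z]}

/-- Two integral combinations of `x`, `y` related by a quarter turn cannot both be smaller than
`max |x| |y|`. -/
theorem max_abs_le_max_abs_rotate (x y : ℝ) (p q : ℤ) (h : ¬(p = 0 ∧ q = 0)) :
    max |x| |y| ≤ max |p * x + q * y| |q * x - p * y| := by
  have one_le : ∀ n : ℤ, n ≠ 0 → ∀ t : ℝ, |t| ≤ |(n : ℝ) * t| := fun n hn t => by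
    rw [abs_mul]
    have h1 : (1 : ℝ) ≤ |(n : ℝ)| := by exact_mod_cast Int.one_le_abs hn
    exact le_mul_of_one_le_left (abs_nonneg t) h1
  by_cases hp : p = 0
  · have hq : q ≠ 0 := fun hq => h ⟨hp, hq⟩
    subst hp
    simpa [max_comm] using max_le_max (one_le q hq x) (one_le q hq y)
  by_cases hq : q = 0
  · subst hq
    simpa using max_le_max (one_le p hp x) (one_le p hp y)
  by_contra! hlt
  obtain ⟨h1, h2⟩ := max_lt_iff.mp hlt
  have hp1 : (1 : ℝ) ≤ (p : ℝ) ^ 2 := by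
    exact_mod_cast (one_le_sq_iff_one_le_abs p).mpr (Int.one_le_abs hp)
  have hq1 : (1 : ℝ) ≤ (q : ℝ) ^ 2 := by
    exact_mod_cast (one_le_sq_iff_one_le_abs q).mpr (Int.one_le_abs hq)
  have hM : max |x| |y| ^ 2 ≤ x ^ 2 + y ^ 2 := by
    rcases max_choice |x| |y| with hc | hc <;> rw [hc, sq_abs] <;>
      linarith [sq_nonneg x, sq_nonneg y]
  have h1' := sq_lt_sq' (by linarith [neg_abs_le ((p : ℝ) * x + q * y)])
    ((le_abs_self _).trans_lt h1)
  have h2' := sq_lt_sq' (by linarith [neg_abs_le ((q : ℝ) * x - p * y)])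
    ((le_abs_self _).trans_lt h2)
  nlinarith [mul_nonneg (by linarith : (0 : ℝ) ≤ (p : ℝ) ^ 2 + q ^ 2 - 2)
    (by positivity : 0 ≤ x ^ 2 + y ^ 2)]

theorem Delta_nonempty (x y z : ℝ) : (Delta x y z).Nonempty :=
  convexHull_nonempty_iff.mpr (insert_nonempty _ _)

theorem isCompact_Delta (x y z : ℝ) : IsCompact (Delta x y z) :=
  (Set.toFinite _).isCompact_convexHull ℝ

/-- The difference of two values of a linear functional on a compact set is at most its width. -/
theorem abs_sub_le_sSup_sub_sInf {K : Set (Fin 3 → ℝ)} (hK : IsCompact K)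
    (f : (Fin 3 → ℝ) →ₗ[ℝ] ℝ) {u v : Fin 3 → ℝ} (hu : u ∈ K) (hv : v ∈ K) :
    |f u - f v| ≤ sSup (f '' K) - sInf (f '' K) := by
  have hc : IsCompact (f '' K) := hK.image f.continuous_of_finiteDimensional
  have hu' := mem_image_of_mem f hu
  have hv' := mem_image_of_mem f hv
  rw [abs_le]
  constructor <;>
    linarith [le_csSup hc.bddAbove hu', le_csSup hc.bddAbove hv',
      csInf_le hc.bddBelow hu', csInf_le hc.bddBelow hv']

theorem linearMap_apply_vec3 (f : (Fin 3 → ℝ) →ₗ[ℝ] ℝ) (u v w : ℝ) :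
    f ![u, v, w] = f ![1, 0, 0] * u + f ![0, 1, 0] * v + f ![0, 0, 1] * w := by
  have h : (![u, v, w] : Fin 3 → ℝ) =
      u • ![1, 0, 0] + v • ![0, 1, 0] + w • ![0, 0, 1] := by
    ext i; fin_cases i <;> simp
  rw [h]
  simp only [map_add, map_smul, smul_eq_mul]
  ring

theorem vec3_mem_fccLattice (a b c k : ℤ) (h : a + b + c = 2 * k) :
    (![2 * a, 2 * b, 2 * c] : Fin 3 → ℝ) ∈ fccLattice := by
  refine ⟨⟨a, rfl⟩, ⟨b, rfl⟩, ⟨c, rfl⟩, ⟨k, ?_⟩⟩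
  have h' : (a : ℝ) + b + c = 2 * k := by exact_mod_cast h
  change (2 * a + 2 * b + 2 * c : ℝ) = 4 * k
  linarith

/-- Every nonzero functional that is integral on `fccLattice` has width at least
`min (max |x| |y|) |z|` on `Delta x y z`. -/
theorem min_le_width_Delta (x y z : ℝ) (f : (Fin 3 → ℝ) →ₗ[ℝ] ℝ)
    (hf : ∀ v ∈ fccLattice, ∃ k : ℤ, f v = (k : ℝ)) (hf0 : f ≠ 0) :
    min (max |x| |y|) |z| ≤ sSup (f '' Delta x y z) - sInf (f '' Delta x y z) := by
  have hsub : {![x, y, z], ![-y, x, -z], ![-x, -y, z], ![y, -x, -z]} ⊆ Delta x y z :=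
    subset_convexHull ℝ _
  have h1 : ![x, y, z] ∈ Delta x y z := hsub (by simp)
  have h2 : ![-y, x, -z] ∈ Delta x y z := hsub (by simp)
  have h3 : ![-x, -y, z] ∈ Delta x y z := hsub (by simp)
  have h4 : ![y, -x, -z] ∈ Delta x y z := hsub (by simp)
  have hK := isCompact_Delta x y z
  have d13 := abs_sub_le_sSup_sub_sInf hK f h1 h3
  have d24 := abs_sub_le_sSup_sub_sInf hK f h2 h4
  have d12 := abs_sub_le_sSup_sub_sInf hK f h1 h2
  have d14 := abs_sub_le_sSup_sub_sInf hK f h1 h4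
  have d32 := abs_sub_le_sSup_sub_sInf hK f h3 h2
  have d34 := abs_sub_le_sSup_sub_sInf hK f h3 h4
  obtain ⟨i, hi⟩ := hf _ (vec3_mem_fccLattice 1 1 0 1 (by norm_num))
  obtain ⟨j, hj⟩ := hf _ (vec3_mem_fccLattice 1 (-1) 0 0 (by norm_num))
  obtain ⟨l, hl⟩ := hf _ (vec3_mem_fccLattice 1 0 1 1 (by norm_num))
  have hext : f ![1, 0, 0] = 0 → f ![0, 1, 0] = 0 → f ![0, 0, 1] = 0 → False := by
    intro ha hb hc
    refine hf0 (LinearMap.ext fun v => ?_)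
    have hv : v = ![v 0, v 1, v 2] := by ext i; fin_cases i <;> rfl
    rw [hv, linearMap_apply_vec3, ha, hb, hc]
    simp
  simp only [linearMap_apply_vec3 f x, linearMap_apply_vec3 f (-x), linearMap_apply_vec3 f y,
    linearMap_apply_vec3 f (-y)] at d13 d24 d12 d14 d32 d34
  rw [linearMap_apply_vec3] at hi hj hl
  push_cast at hi hj hl
  generalize sSup (f '' Delta x y z) - sInf (f '' Delta x y z) = w at *
  generalize f ![1, 0, 0] = a at *
  generalize f ![0, 1, 0] = b at *
  generalize f ![0, 0, 1] = c at *
  have ha : a = (i + j) / 4 := by linarith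
  have hb : b = (i - j) / 4 := by linarith
  have hc : c = ((2 * l - i - j : ℤ) : ℝ) / 4 := by push_cast; linarith
  obtain ⟨k, hk⟩ : ∃ k : ℤ, k = 2 * l - i - j := ⟨_, rfl⟩
  rw [← hk] at hc
  rw [abs_le] at d13 d24 d12 d14 d32 d34
  have hcz : |2 * c * z| = |(k : ℝ)| * |z| / 2 := by
    rw [hc, show 2 * ((k : ℝ) / 4) * z = k * z / 2 by ring, abs_div, abs_mul, abs_two]
  rcases lt_or_ge |k| 2 with hk2 | hk2
  · by_cases hk0 : k = 0
    · obtain ⟨q, hq⟩ : ∃ q : ℤ, q = i - l := ⟨_, rfl⟩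
      have hip : i = l + q := by omega
      have hjq : j = l - q := by omega
      have hlq : ¬(l = 0 ∧ q = 0) := by
        rintro ⟨rfl, rfl⟩
        refine hext ?_ ?_ ?_
        · rw [ha, hip, hjq]; simp
        · rw [hb, hip, hjq]; simp
        · rw [hc, hk0]; simp
      refine (min_le_left _ _).trans ((max_abs_le_max_abs_rotate x y l q hlq).trans ?_)
      have ha' : a = l / 2 := by rw [ha, hip, hjq]; push_cast; ring
      have hb' : b = q / 2 := by rw [hb, hip, hjq]; push_cast; ring
      subst ha' hb'
      refine max_le (abs_le.mpr ⟨?_, ?_⟩) (abs_le.mpr ⟨?_, ?_⟩) <;>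
        linarith [d13.1, d13.2, d24.1, d24.2]
    · have hk1 : |k| = 1 := by have := Int.one_le_abs hk0; omega
      have hij : ¬(i = 0 ∧ -j = 0) := by
        rintro ⟨h, h'⟩
        rcases abs_eq (zero_le_one' ℤ) |>.mp hk1 with h'' | h'' <;> omega
      have hM := max_abs_le_max_abs_rotate x y i (-j) hij
      rw [show |(k : ℝ)| = 1 by exact_mod_cast hk1] at hcz
      have hw : |z| / 2 + max |(i : ℝ) * x + (-j : ℤ) * y| |((-j : ℤ) : ℝ) * x - i * y| / 2 ≤ w := by
        rw [show |z| / 2 = |2 * c * z| by rw [hcz]; ring]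
        subst ha hb
        rcases max_choice |(i : ℝ) * x + (-j : ℤ) * y| |((-j : ℤ) : ℝ) * x - i * y| with h | h <;>
          rw [h] <;> push_cast <;>
          rcases abs_cases (2 * c * z) with ⟨e1, -⟩ | ⟨e1, -⟩ <;> rw [e1]
        · rcases abs_cases ((i : ℝ) * x + -j * y) with ⟨e2, -⟩ | ⟨e2, -⟩ <;> rw [e2] <;> linarith
        · rcases abs_cases ((i : ℝ) * x + -j * y) with ⟨e2, -⟩ | ⟨e2, -⟩ <;> rw [e2] <;> linarith
        · rcases abs_cases (-(j : ℝ) * x - i * y) with ⟨e2, -⟩ | ⟨e2, -⟩ <;> rw [e2] <;> linarith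
        · rcases abs_cases (-(j : ℝ) * x - i * y) with ⟨e2, -⟩ | ⟨e2, -⟩ <;> rw [e2] <;> linarith
      linarith [min_le_left (max |x| |y|) |z|, min_le_right (max |x| |y|) |z|]
  · have hk2' : (2 : ℝ) ≤ |(k : ℝ)| := by exact_mod_cast hk2
    have hzw : |2 * c * z| ≤ w := abs_le.mpr ⟨by linarith, by linarith⟩
    refine (min_le_right _ _).trans ?_
    nlinarith [mul_le_mul_of_nonneg_right hk2' (abs_nonneg z)]

/-- Twice a bound for a functional on the vertices bounds the lattice width of `Delta x y z`. -/
theorem latticeWidthIn_Delta_le (x y z c : ℝ) (f : (Fin 3 → ℝ) →ₗ[ℝ] ℝ)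
    (hf : ∀ v ∈ fccLattice, ∃ k : ℤ, f v = (k : ℝ)) (hf0 : f ≠ 0)
    (hc : ∀ v ∈ ({![x, y, z], ![-y, x, -z], ![-x, -y, z], ![y, -x, -z]} : Set (Fin 3 → ℝ)),
      |f v| ≤ c) :
    latticeWidthIn fccLattice (Delta x y z) ≤ 2 * c := by
  have hsub : Delta x y z ⊆ f ⁻¹' Icc (-c) c :=
    convexHull_min (fun v hv => abs_le.mp (hc v hv)) ((convex_Icc _ _).linear_preimage f)
  have hne : (f '' Delta x y z).Nonempty := (Delta_nonempty x y z).image f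
  have hsup : sSup (f '' Delta x y z) ≤ c :=
    csSup_le hne (forall_mem_image.mpr fun v hv => (hsub hv).2)
  have hinf : -c ≤ sInf (f '' Delta x y z) :=
    le_csInf hne (forall_mem_image.mpr fun v hv => (hsub hv).1)
  have hle : latticeWidthIn fccLattice (Delta x y z) ≤
      sSup (f '' Delta x y z) - sInf (f '' Delta x y z) := by
    refine csInf_le ⟨min (max |x| |y|) |z|, ?_⟩ ⟨f, hf, hf0, rfl⟩
    rintro w ⟨g, hg, hg0, rfl⟩
    exact min_le_width_Delta x y z g hg hg0
  linarith

theorem latticeWidthIn_Delta (x y z : ℝ) :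
    latticeWidthIn fccLattice (Delta x y z) = min (max |x| |y|) |z| := by
  have hproj : ∀ i : Fin 3, ((1 / 2 : ℝ) • LinearMap.proj i : (Fin 3 → ℝ) →ₗ[ℝ] ℝ) ≠ 0 := by
    intro i h
    have h1 := LinearMap.congr_fun h (fun _ => 1)
    norm_num at h1
  have half : ∀ t : ℝ, |1 / 2 * t| = |t| / 2 := fun t => by
    rw [abs_mul, abs_of_pos one_half_pos]; ring
  have hx := latticeWidthIn_Delta_le x y z (max |x| |y| / 2) ((1 / 2 : ℝ) • LinearMap.proj 0)
    (by rintro v ⟨⟨a, ha⟩, -⟩; exact ⟨a, by simp [ha]⟩) (hproj 0) (by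
      have e1 := le_max_left |x| |y|
      have e2 := le_max_right |x| |y|
      rintro v (rfl | rfl | rfl | rfl) <;>
        simp only [LinearMap.smul_apply, LinearMap.proj_apply, smul_eq_mul, half,
          Matrix.cons_val_zero, abs_neg] <;> linarith)
  have hz := latticeWidthIn_Delta_le x y z (|z| / 2) ((1 / 2 : ℝ) • LinearMap.proj 2)
    (by rintro v ⟨-, -, ⟨a, ha⟩, -⟩; exact ⟨a, by simp [ha]⟩) (hproj 2) (by
      have val : ∀ a b c : ℝ, (![a, b, c] : Fin 3 → ℝ) 2 = c := fun _ _ _ => rfl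
      rintro v (rfl | rfl | rfl | rfl) <;>
        simp only [LinearMap.smul_apply, LinearMap.proj_apply, smul_eq_mul, half, val, abs_neg,
          le_refl])
  refine le_antisymm (le_min (by linarith) (by linarith)) (le_csInf ⟨_, _, ?_, hproj 0, rfl⟩ ?_)
  · rintro v ⟨⟨a, ha⟩, -⟩
    exact ⟨a, by simp [ha]⟩
  · rintro w ⟨g, hg, hg0, rfl⟩
    exact min_le_width_Delta x y z g hg hg0

theorem eq_of_le_of_le_abs {x y : ℝ} (hden : x ^ 2 + y ^ 2 - 2 * x - 2 * y ≠ 0)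
    (hx : 2 + √2 ≤ x)
    (hz : 2 + √2 ≤ |(x ^ 2 + y ^ 2) / (x ^ 2 + y ^ 2 - 2 * x - 2 * y)|) :
    x = 2 + √2 ∧ y = √2 := by
  have h2 : √2 ^ 2 = 2 := Real.sq_sqrt (by norm_num)
  have h0 : 0 ≤ √2 := Real.sqrt_nonneg 2
  have hD : 0 < x ^ 2 + y ^ 2 - 2 * x - 2 * y := by nlinarith [sq_nonneg (y - 1)]
  rw [abs_of_nonneg (by positivity), le_div_iff₀ hD] at hz
  have hdisk : (x - √2) ^ 2 + (y - √2) ^ 2 ≤ 4 := by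
    nlinarith [mul_le_mul_of_nonneg_left hz (show 0 ≤ √2 - 1 by nlinarith)]
  have hx' : x = 2 + √2 := by nlinarith [sq_nonneg (y - √2)]
  subst hx'
  refine ⟨rfl, ?_⟩
  have : (y - √2) ^ 2 = 0 := le_antisymm (by nlinarith) (sq_nonneg _)
  linarith [pow_eq_zero_iff (two_ne_zero) |>.mp this]

theorem eq_or_eq_of_le_max_abs {x y : ℝ} (hden : x ^ 2 + y ^ 2 - 2 * x - 2 * y ≠ 0)
    (hM : 2 + √2 ≤ max |x| |y|)
    (hz : 2 + √2 ≤ |(x ^ 2 + y ^ 2) / (x ^ 2 + y ^ 2 - 2 * x - 2 * y)|) :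
    (x = 2 + √2 ∧ y = √2) ∨ (x = √2 ∧ y = 2 + √2) := by
  have h0 : 0 ≤ √2 := Real.sqrt_nonneg 2
  have hs : 0 < x + y := by
    by_contra! hs
    have hr : x ^ 2 + y ^ 2 ≤ x ^ 2 + y ^ 2 - 2 * x - 2 * y := by linarith
    have h1 : 0 ≤ x ^ 2 + y ^ 2 := by positivity
    rw [abs_of_nonneg (div_nonneg h1 (h1.trans hr))] at hz
    linarith [div_le_one_of_le₀ hr (h1.trans hr)]
  rcases le_total y x with hyx | hxy
  · left
    have hyx' : |y| ≤ x := abs_le.mpr ⟨by linarith, hyx⟩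
    refine eq_of_le_of_le_abs hden (hM.trans (max_le (abs_le.mpr ⟨?_, le_rfl⟩) hyx')) hz
    linarith
  · right
    have hxy' : |x| ≤ y := abs_le.mpr ⟨by linarith, hxy⟩
    have hcomm : x ^ 2 + y ^ 2 - 2 * x - 2 * y = y ^ 2 + x ^ 2 - 2 * y - 2 * x := by ring
    rw [hcomm] at hden hz
    rw [add_comm (x ^ 2)] at hz
    refine (eq_of_le_of_le_abs hden (hM.trans (max_le hxy' (abs_le.mpr ⟨?_, le_rfl⟩))) hz).symm
    linarith

theorem width_Delta_le_and_eq_iff (x y z : ℝ)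
    (hden : x ^ 2 + y ^ 2 - 2 * x - 2 * y ≠ 0)
    (hz : z = (x ^ 2 + y ^ 2) / (x ^ 2 + y ^ 2 - 2 * x - 2 * y)) :
    latticeWidthIn fccLattice (Delta x y z) ≤ 2 + Real.sqrt 2 ∧
    (latticeWidthIn fccLattice (Delta x y z) = 2 + Real.sqrt 2 ↔
      (x = 2 + Real.sqrt 2 ∧ y = Real.sqrt 2 ∧ z = 2 + Real.sqrt 2) ∨
      (x = Real.sqrt 2 ∧ y = 2 + Real.sqrt 2 ∧ z = 2 + Real.sqrt 2)) := by
  rw [latticeWidthIn_Delta]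
  have h0 : 0 ≤ √2 := Real.sqrt_nonneg 2
  have key : 2 + √2 ≤ min (max |x| |y|) |z| →
      (x = 2 + √2 ∧ y = √2 ∧ z = 2 + √2) ∨ (x = √2 ∧ y = 2 + √2 ∧ z = 2 + √2) := by
    intro h
    obtain ⟨hM, hz'⟩ := le_min_iff.mp h
    rw [hz] at hz'
    have h2 : √2 ^ 2 = 2 := Real.sq_sqrt (by norm_num)
    rcases eq_or_eq_of_le_max_abs hden hM hz' with ⟨hx, hy⟩ | ⟨hx, hy⟩
    · refine Or.inl ⟨hx, hy, ?_⟩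
      rw [hz, div_eq_iff hden, hx, hy]
      linear_combination (-2 - 2 * √2) * h2
    · refine Or.inr ⟨hx, hy, ?_⟩
      rw [hz, div_eq_iff hden, hx, hy]
      linear_combination (-2 - 2 * √2) * h2
  have heq : (x = 2 + √2 ∧ y = √2 ∧ z = 2 + √2) ∨ (x = √2 ∧ y = 2 + √2 ∧ z = 2 + √2) →
      min (max |x| |y|) |z| = 2 + √2 := by
    have h2 : |2 + √2| = 2 + √2 := abs_of_nonneg (by linarith)
    rintro (⟨rfl, rfl, hz'⟩ | ⟨rfl, rfl, hz'⟩) <;> rw [hz', h2, abs_of_nonneg h0]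
    · rw [max_eq_left (by linarith), min_self]
    · rw [max_eq_right (by linarith), min_self]
  refine ⟨?_, fun h => key h.ge, heq⟩
  by_contra! hlt
  exact hlt.ne' (heq (key hlt.le))
end

section
/- Let Δ ⊆ ℝ³ be the tetrahedron with vertices A = (2+√2, √2, 2+√2), B = (−√2, 2+√2, −2−√2), C = (−2−√2, −√2, 2+√2) and D = (√2, −2−√2, −2−√2). Then the interior of Δ contains no point of the affine lattice Λ₋₁ := {(a,b,c) ∈ ℝ³ : a, b, c ∈ 1+2ℤ, a+b+c ∈ 1+4ℤ}, and the lattice width of Δ with respect to Λ equals 2 + √2. -/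
open Set

/-- The translated (affine) lattice
`Λ₋₁ = {(a,b,c) : a,b,c ∈ 1+2ℤ, a+b+c ∈ 1+4ℤ}`. -/
def fccLatticeShifted : Set (Fin 3 → ℝ) :=
  { p | (∃ a : ℤ, p 0 = 1 + 2 * (a : ℝ)) ∧ (∃ b : ℤ, p 1 = 1 + 2 * (b : ℝ)) ∧
        (∃ c : ℤ, p 2 = 1 + 2 * (c : ℝ)) ∧
        (∃ k : ℤ, p 0 + p 1 + p 2 = 1 + 4 * (k : ℝ)) }

/-- The tetrahedron `Δ` with vertices `A = (2+√2, √2, 2+√2)`,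
`B = (−√2, 2+√2, −2−√2)`, `C = (−2−√2, −√2, 2+√2)`, `D = (√2, −2−√2, −2−√2)`. -/
noncomputable def DeltaMax : Set (Fin 3 → ℝ) :=
  convexHull ℝ
    {![2 + Real.sqrt 2, Real.sqrt 2, 2 + Real.sqrt 2],
     ![-Real.sqrt 2, 2 + Real.sqrt 2, -2 - Real.sqrt 2],
     ![-2 - Real.sqrt 2, -Real.sqrt 2, 2 + Real.sqrt 2],
     ![Real.sqrt 2, -2 - Real.sqrt 2, -2 - Real.sqrt 2]}

theorem convexHull_subset_linear_le {ι : Type*} {s : Set (ι → ℝ)} (f : (ι → ℝ) →ₗ[ℝ] ℝ) {c : ℝ}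
    (h : ∀ v ∈ s, f v ≤ c) : ∀ p ∈ convexHull ℝ s, f p ≤ c :=
  fun _ hp => convexHull_min (t := {p | f p ≤ c}) h (convex_halfSpace_le f.isLinear c) hp

theorem linear_lt_of_mem_interior {ι : Type*} [Finite ι] {K : Set (ι → ℝ)}
    (f : (ι → ℝ) →ₗ[ℝ] ℝ) (hf : f ≠ 0) {c : ℝ} (h : ∀ p ∈ K, f p ≤ c) {p : ι → ℝ}
    (hp : p ∈ interior K) : f p < c := by
  have hopen : IsOpenMap f :=
    f.isOpenMap_of_finiteDimensional (LinearMap.surjective hf)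
  have hsub : f '' interior K ⊆ interior (Iic c) :=
    interior_maximal (by rintro _ ⟨q, hq, rfl⟩; exact h q (interior_subset hq))
      (hopen _ isOpen_interior)
  rw [interior_Iic] at hsub
  exact hsub ⟨p, hp, rfl⟩

/-- The linear functional `p ↦ a * p 0 + b * p 1 + c * p 2`. -/
noncomputable def coordFunctional (a b c : ℝ) : (Fin 3 → ℝ) →ₗ[ℝ] ℝ :=
  a • LinearMap.proj 0 + b • LinearMap.proj 1 + c • LinearMap.proj 2

@[simp]
theorem coordFunctional_apply (a b c : ℝ) (p : Fin 3 → ℝ) :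
    coordFunctional a b c p = a * p 0 + b * p 1 + c * p 2 := by
  simp [coordFunctional]

theorem coordFunctional_ne_zero {a b c : ℝ} (ha : a ≠ 0) : coordFunctional a b c ≠ 0 := by
  intro h
  apply ha
  simpa using LinearMap.congr_fun h ![1, 0, 0]

theorem exists_eq_coordFunctional (f : (Fin 3 → ℝ) →ₗ[ℝ] ℝ) :
    ∃ a b c, f = coordFunctional a b c := by
  refine ⟨f (Pi.single 0 1), f (Pi.single 1 1), f (Pi.single 2 1), ?_⟩
  ext i
  fin_cases i <;> simp

theorem coordFunctional_le_of_mem_DeltaMax {a b c w : ℝ}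
    (hA : a * (2 + √2) + b * √2 + c * (2 + √2) ≤ w)
    (hB : a * -√2 + b * (2 + √2) + c * (-2 - √2) ≤ w)
    (hC : a * (-2 - √2) + b * -√2 + c * (2 + √2) ≤ w)
    (hD : a * √2 + b * (-2 - √2) + c * (-2 - √2) ≤ w) :
    ∀ p ∈ DeltaMax, coordFunctional a b c p ≤ w := by
  apply convexHull_subset_linear_le
  rintro v (rfl | rfl | rfl | rfl) <;> simp <;> linarith

theorem DeltaMax_facet_lt {a b c w : ℝ} (ha : a ≠ 0)
    (hA : a * (2 + √2) + b * √2 + c * (2 + √2) ≤ w)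
    (hB : a * -√2 + b * (2 + √2) + c * (-2 - √2) ≤ w)
    (hC : a * (-2 - √2) + b * -√2 + c * (2 + √2) ≤ w)
    (hD : a * √2 + b * (-2 - √2) + c * (-2 - √2) ≤ w) {p : Fin 3 → ℝ}
    (hp : p ∈ interior DeltaMax) : a * p 0 + b * p 1 + c * p 2 < w := by
  simpa using linear_lt_of_mem_interior _ (coordFunctional_ne_zero ha)
    (coordFunctional_le_of_mem_DeltaMax hA hB hC hD) hp

theorem sqrt_two_bounds : √2 * √2 = 2 ∧ 1.414 < √2 ∧ √2 < 1.415 :=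
  ⟨Real.mul_self_sqrt (by norm_num), Real.lt_sqrt_of_sq_lt (by norm_num),
    (Real.sqrt_lt' (by norm_num)).2 (by norm_num)⟩

theorem abs_le_of_cast_bounds {n : ℤ} {k : ℕ} (h₁ : (n : ℝ) < k + 1) (h₂ : -(k + 1 : ℝ) < n) :
    -(k : ℤ) ≤ n ∧ n ≤ k := by
  have h₁' : n < k + 1 := by exact_mod_cast h₁
  have h₂' : -((k : ℤ) + 1) < n := by exact_mod_cast h₂
  omega

theorem fccLatticeShifted_not_facets_lt {a b c k : ℤ}
    (hk : (1 + 2 * a) + (1 + 2 * b) + (1 + 2 * c) = 1 + 4 * k)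
    (h₁ : -1 * (1 + 2 * (a : ℝ)) + (1 + √2) * (1 + 2 * b) + √2 * (1 + 2 * c) < 2 + 2 * √2)
    (h₂ : (-1 - √2) * (1 + 2 * (a : ℝ)) + -1 * (1 + 2 * b) + -√2 * (1 + 2 * c) < 2 + 2 * √2)
    (h₃ : 1 * (1 + 2 * (a : ℝ)) + (-1 - √2) * (1 + 2 * b) + √2 * (1 + 2 * c) < 2 + 2 * √2)
    (h₄ : (1 + √2) * (1 + 2 * (a : ℝ)) + 1 * (1 + 2 * b) + -√2 * (1 + 2 * c) < 2 + 2 * √2) :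
    False := by
  obtain ⟨hs, hs₁, hs₂⟩ := sqrt_two_bounds
  have hq : 0 < 1 + √2 := by linarith
  have hc : -2 ≤ c ∧ c ≤ 1 := by
    have h₅ : (c : ℝ) < 2 := by nlinarith
    have h₆ : (-3 : ℝ) < c := by nlinarith
    have h₅' : c < 2 := by exact_mod_cast h₅
    have h₆' : -3 < c := by exact_mod_cast h₆
    omega
  obtain ⟨hc₁, hc₂⟩ := hc
  have hc' : (-2 : ℝ) ≤ c ∧ (c : ℝ) ≤ 1 := by exact_mod_cast And.intro hc₁ hc₂
  have h₁' := mul_lt_mul_of_pos_left h₁ hq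
  have h₂' := mul_lt_mul_of_pos_left h₂ hq
  have h₃' := mul_lt_mul_of_pos_left h₃ hq
  have h₄' := mul_lt_mul_of_pos_left h₄ hq
  have hs' : ∀ x : ℝ, √2 * (√2 * x) = 2 * x := fun x => by rw [← mul_assoc, hs]
  have hb₁ : (1 + 2 * (b : ℝ)) * (2 + √2) < 4 + 3 * √2 - (1 + 2 * c) := by
    linarith [hs' b, hs' c]
  have hb₂ : -(1 + 2 * (b : ℝ)) * (2 + √2) < 4 + 3 * √2 - (1 + 2 * c) := by
    linarith [hs' b, hs' c]
  have ha₁ : (1 + 2 * (a : ℝ)) * (2 + √2) < 4 + 3 * √2 + (1 + 2 * c) := by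
    linarith [hs' a, hs' c]
  have ha₂ : -(1 + 2 * (a : ℝ)) * (2 + √2) < 4 + 3 * √2 + (1 + 2 * c) := by
    linarith [hs' a, hs' c]
  obtain ⟨hb₃, hb₄⟩ : -(2 : ℕ) ≤ b ∧ b ≤ (2 : ℕ) :=
    abs_le_of_cast_bounds (by push_cast; nlinarith) (by push_cast; nlinarith)
  obtain ⟨ha₃, ha₄⟩ : -(2 : ℕ) ≤ a ∧ a ≤ (2 : ℕ) :=
    abs_le_of_cast_bounds (by push_cast; nlinarith) (by push_cast; nlinarith)
  push_cast at ha₃ ha₄ hb₃ hb₄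
  clear h₁' h₂' h₃' h₄' ha₁ ha₂ hb₁ hb₂ hc' hs'
  interval_cases c <;> interval_cases b <;> interval_cases a <;> first
    | omega
    | (push_cast at h₁ h₂ h₃ h₄; linarith)

theorem DeltaMax_interior_disjoint_fccLatticeShifted :
    ∀ p ∈ fccLatticeShifted, p ∉ interior DeltaMax := by
  rintro p ⟨⟨a, ha⟩, ⟨b, hb⟩, ⟨c, hc⟩, ⟨k, hk⟩⟩ hp
  obtain ⟨hs, hs₁, hs₂⟩ := sqrt_two_bounds
  have h₁ := DeltaMax_facet_lt (a := -1) (b := 1 + √2) (c := √2) (w := 2 + 2 * √2)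
    (by norm_num) (by nlinarith) (by nlinarith) (by nlinarith) (by nlinarith) hp
  have h₂ := DeltaMax_facet_lt (a := -1 - √2) (b := -1) (c := -√2) (w := 2 + 2 * √2)
    (by linarith) (by nlinarith) (by nlinarith) (by nlinarith) (by nlinarith) hp
  have h₃ := DeltaMax_facet_lt (a := 1) (b := -1 - √2) (c := √2) (w := 2 + 2 * √2)
    (by norm_num) (by nlinarith) (by nlinarith) (by nlinarith) (by nlinarith) hp
  have h₄ := DeltaMax_facet_lt (a := 1 + √2) (b := 1) (c := -√2) (w := 2 + 2 * √2)
    (by linarith) (by nlinarith) (by nlinarith) (by nlinarith) (by nlinarith) hp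
  rw [ha, hb, hc] at h₁ h₂ h₃ h₄ hk
  exact fccLatticeShifted_not_facets_lt (by exact_mod_cast hk) h₁ h₂ h₃ h₄

theorem isCompact_DeltaMax : IsCompact DeltaMax :=
  (Set.toFinite _).isCompact_convexHull (𝕜 := ℝ)

theorem sub_le_sSup_sub_sInf_image {ι : Type*} [Finite ι] {K : Set (ι → ℝ)} (hK : IsCompact K)
    (f : (ι → ℝ) →ₗ[ℝ] ℝ) {p q : ι → ℝ} (hp : p ∈ K) (hq : q ∈ K) :
    f p - f q ≤ sSup (f '' K) - sInf (f '' K) := by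
  have hc := hK.image f.continuous_of_finiteDimensional
  exact sub_le_sub (le_csSup hc.bddAbove ⟨p, hp, rfl⟩) (csInf_le hc.bddBelow ⟨q, hq, rfl⟩)

/-- The dual of `fccLattice` consists of the integer vectors with entries of equal parity,
divided by four. -/
theorem exists_int_of_fccLattice_integer {α β γ : ℝ}
    (h : ∀ v ∈ fccLattice, ∃ k : ℤ, coordFunctional α β γ v = k) :
    ∃ a b c : ℤ, 2 ∣ a - b ∧ 2 ∣ b - c ∧ α = a / 4 ∧ β = b / 4 ∧ γ = c / 4 := by
  have hmem : ∀ x y z k : ℤ, x + y + z = 2 * k →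
      ∃ m : ℤ, α * (2 * x) + β * (2 * y) + γ * (2 * z) = m := by
    intro x y z k hk
    have hk' : (x + y + z : ℝ) = 2 * k := by exact_mod_cast hk
    simpa using h ![2 * x, 2 * y, 2 * z]
      ⟨⟨x, rfl⟩, ⟨y, rfl⟩, ⟨z, rfl⟩, ⟨k, by simp; linarith⟩⟩
  obtain ⟨i, hi⟩ := hmem 1 1 0 1 rfl
  obtain ⟨j, hj⟩ := hmem 1 (-1) 0 0 rfl
  obtain ⟨k, hk⟩ := hmem 0 1 1 1 rfl
  obtain ⟨l, hl⟩ := hmem 0 1 (-1) 0 rfl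
  push_cast at hi hj hk hl
  have hb : i - j = k + l := by
    have : (i - j : ℝ) = k + l := by linarith
    exact_mod_cast this
  refine ⟨i + j, i - j, k - l, by omega, by omega, ?_, ?_, ?_⟩ <;> push_cast <;> linarith

theorem eq_zero_of_edge_lt {a b c : ℤ} (hab : 2 ∣ a - b) (hbc : 2 ∣ b - c)
    (hAC : |a * (2 + √2) + b * √2| < 2 * (2 + √2))
    (hBD : |b * (2 + √2) - a * √2| < 2 * (2 + √2))
    (hAB : |a * (1 + √2) - b + c * (2 + √2)| < 2 * (2 + √2))
    (hAD : |a + b * (1 + √2) + c * (2 + √2)| < 2 * (2 + √2))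
    (hBC : |a + b * (1 + √2) - c * (2 + √2)| < 2 * (2 + √2))
    (hCD : |a * (1 + √2) - b - c * (2 + √2)| < 2 * (2 + √2)) :
    a = 0 ∧ b = 0 ∧ c = 0 := by
  obtain ⟨hs, hs₁, hs₂⟩ := sqrt_two_bounds
  rw [abs_lt] at hAC hBD hAB hAD hBC hCD
  obtain ⟨hAC₁, hAC₂⟩ := hAC
  obtain ⟨hBD₁, hBD₂⟩ := hBD
  obtain ⟨hAB₁, hAB₂⟩ := hAB
  obtain ⟨hAD₁, hAD₂⟩ := hAD
  obtain ⟨hBC₁, hBC₂⟩ := hBC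
  obtain ⟨hCD₁, hCD₂⟩ := hCD
  have hc : -(1 : ℕ) ≤ c ∧ c ≤ (1 : ℕ) :=
    abs_le_of_cast_bounds (by push_cast; nlinarith) (by push_cast; nlinarith)
  have ha : -(2 : ℕ) ≤ a ∧ a ≤ (2 : ℕ) :=
    abs_le_of_cast_bounds (by push_cast; nlinarith) (by push_cast; nlinarith)
  have hb : -(2 : ℕ) ≤ b ∧ b ≤ (2 : ℕ) :=
    abs_le_of_cast_bounds (by push_cast; nlinarith) (by push_cast; nlinarith)
  obtain ⟨ha₁, ha₂⟩ := ha
  obtain ⟨hb₁, hb₂⟩ := hb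
  obtain ⟨hc₁, hc₂⟩ := hc
  push_cast at ha₁ ha₂ hb₁ hb₂ hc₁ hc₂
  interval_cases c <;> interval_cases b <;> interval_cases a <;> first
    | omega
    | (exfalso
       push_cast at hAC₁ hAC₂ hBD₁ hBD₂ hAB₁ hAB₂ hAD₁ hAD₂ hBC₁ hBC₂ hCD₁ hCD₂
       linarith)

theorem le_width_DeltaMax {f : (Fin 3 → ℝ) →ₗ[ℝ] ℝ}
    (hint : ∀ v ∈ fccLattice, ∃ k : ℤ, f v = k) (hf : f ≠ 0) :
    2 + √2 ≤ sSup (f '' DeltaMax) - sInf (f '' DeltaMax) := by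
  obtain ⟨α, β, γ, rfl⟩ := exists_eq_coordFunctional f
  obtain ⟨a, b, c, hab, hbc, rfl, rfl, rfl⟩ := exists_int_of_fccLattice_integer hint
  by_contra! hlt
  have hdiff : ∀ p ∈ DeltaMax, ∀ q ∈ DeltaMax,
      |coordFunctional (a / 4) (b / 4) (c / 4) p - coordFunctional (a / 4) (b / 4) (c / 4) q|
        < 2 + √2 := by
    intro p hp q hq
    refine abs_lt.2 ⟨?_, ?_⟩
    · linarith [sub_le_sSup_sub_sInf_image isCompact_DeltaMax
        (coordFunctional (a / 4) (b / 4) (c / 4)) hq hp]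
    · linarith [sub_le_sSup_sub_sInf_image isCompact_DeltaMax
        (coordFunctional (a / 4) (b / 4) (c / 4)) hp hq]
  have hA : ![2 + √2, √2, 2 + √2] ∈ DeltaMax := subset_convexHull _ _ (by simp)
  have hB : ![-√2, 2 + √2, -2 - √2] ∈ DeltaMax := subset_convexHull _ _ (by simp)
  have hC : ![-2 - √2, -√2, 2 + √2] ∈ DeltaMax := subset_convexHull _ _ (by simp)
  have hD : ![√2, -2 - √2, -2 - √2] ∈ DeltaMax := subset_convexHull _ _ (by simp)
  have hAC := hdiff _ hA _ hC
  have hBD := hdiff _ hB _ hD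
  have hAB := hdiff _ hA _ hB
  have hAD := hdiff _ hA _ hD
  have hBC := hdiff _ hB _ hC
  have hCD := hdiff _ hC _ hD
  simp only [coordFunctional_apply, Matrix.cons_val, abs_lt] at hAC hBD hAB hAD hBC hCD
  obtain ⟨rfl, rfl, rfl⟩ := eq_zero_of_edge_lt hab hbc
    (abs_lt.2 ⟨by linarith, by linarith⟩) (abs_lt.2 ⟨by linarith, by linarith⟩)
    (abs_lt.2 ⟨by linarith, by linarith⟩) (abs_lt.2 ⟨by linarith, by linarith⟩)
    (abs_lt.2 ⟨by linarith, by linarith⟩) (abs_lt.2 ⟨by linarith, by linarith⟩)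
  exact hf (by simp [coordFunctional])

theorem width_DeltaMax_half_first_coord_le :
    sSup (coordFunctional (1 / 2) 0 0 '' DeltaMax) -
      sInf (coordFunctional (1 / 2) 0 0 '' DeltaMax) ≤ 2 + √2 := by
  have hne : (coordFunctional (1 / 2) 0 0 '' DeltaMax).Nonempty :=
    (convexHull_nonempty_iff.2 (insert_nonempty _ _)).image _
  have hs := Real.sqrt_nonneg 2
  have h₁ : sSup (coordFunctional (1 / 2) 0 0 '' DeltaMax) ≤ (2 + √2) / 2 := by
    refine csSup_le hne (forall_mem_image.2 ?_)
    apply coordFunctional_le_of_mem_DeltaMax <;> linarith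
  have h₂ : -((2 + √2) / 2) ≤ sInf (coordFunctional (1 / 2) 0 0 '' DeltaMax) := by
    refine le_csInf hne (forall_mem_image.2 fun p hp => ?_)
    have h := coordFunctional_le_of_mem_DeltaMax (a := -(1 / 2)) (b := 0) (c := 0)
      (w := (2 + √2) / 2) (by linarith) (by linarith) (by linarith) (by linarith) p hp
    simp only [coordFunctional_apply] at h ⊢
    linarith
  linarith

theorem latticeWidthIn_fccLattice_DeltaMax :
    latticeWidthIn fccLattice DeltaMax = 2 + √2 := by
  have hmem : ∀ v ∈ fccLattice, ∃ k : ℤ, coordFunctional (1 / 2) 0 0 v = k := by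
    rintro v ⟨⟨a, ha⟩, -⟩
    exact ⟨a, by simp [ha]⟩
  have hne : coordFunctional (1 / 2) 0 0 ≠ 0 := coordFunctional_ne_zero (by norm_num)
  apply le_antisymm
  · refine le_trans (csInf_le ?_ ⟨_, hmem, hne, rfl⟩) width_DeltaMax_half_first_coord_le
    refine ⟨2 + √2, ?_⟩
    rintro w ⟨f, hint, hf, rfl⟩
    exact le_width_DeltaMax hint hf
  · refine le_csInf ⟨_, _, hmem, hne, rfl⟩ ?_
    rintro w ⟨f, hint, hf, rfl⟩
    exact le_width_DeltaMax hint hf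

theorem DeltaMax_hollow_and_width :
    (∀ p ∈ fccLatticeShifted, p ∉ interior DeltaMax) ∧
    latticeWidthIn fccLattice DeltaMax = 2 + Real.sqrt 2 :=
  ⟨DeltaMax_interior_disjoint_fccLatticeShifted, latticeWidthIn_fccLattice_DeltaMax⟩
end

section
/- Let S₀ ⊆ ℝ⁴ be the simplex with vertices (0,0,0,0), (1,0,0,0), (0,1,0,0), (0,0,1,0) and (6,14,17,101), and let S := (102/101)·S₀ be its dilation by the factor 102/101. Then the interior of S contains no point of ℤ⁴, and the lattice width of S with respect to ℤ⁴ equals 408/101 = 4 + 4/101. -/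
open Set Pointwise

/-- The empty 4-simplex `S₀` with vertices `0`, `e₁`, `e₂`, `e₃`, `(6,14,17,101)`. -/
def S₀ : Set (Fin 4 → ℝ) :=
  convexHull ℝ {![0, 0, 0, 0], ![1, 0, 0, 0], ![0, 1, 0, 0], ![0, 0, 1, 0],
    ![6, 14, 17, 101]}

/-- A linear functional bounded by `M` at the vertices of `S₀` is bounded by `c * M` on `c • S₀`. -/
lemma le_mul_of_mem_smul_S₀ (f : (Fin 4 → ℝ) →ₗ[ℝ] ℝ) {c M : ℝ} (hc : 0 ≤ c)
    (hM : ∀ v ∈ ({![0, 0, 0, 0], ![1, 0, 0, 0], ![0, 1, 0, 0], ![0, 0, 1, 0],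
      ![6, 14, 17, 101]} : Set (Fin 4 → ℝ)), f v ≤ M) :
    ∀ x ∈ c • S₀, f x ≤ c * M := by
  rintro _ ⟨y, hy, rfl⟩
  have hy' : y ∈ {x | f x ≤ M} := convexHull_min hM (convex_halfSpace_le f.isLinear M) hy
  simpa using mul_le_mul_of_nonneg_left hy' hc

/-- A nonzero linear functional does not attain an upper bound in the interior of a set. -/
lemma lt_of_mem_interior_of_forall_le {E : Type*} [AddCommGroup E] [Module ℝ E]
    [TopologicalSpace E] [IsTopologicalAddGroup E] [ContinuousSMul ℝ E]
    {K : Set E} (f : E →ₗ[ℝ] ℝ) (hf : f ≠ 0) {b : ℝ}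
    (hb : ∀ x ∈ K, f x ≤ b) {x : E} (hx : x ∈ interior K) : f x < b := by
  have hopen : IsOpenMap f :=
    f.isOpenMap_of_finiteDimensional (LinearMap.surjective hf)
  have hsub : f '' K ⊆ Iic b := image_subset_iff.2 hb
  have h : f x ∈ interior (Iic b) :=
    interior_mono hsub (hopen.image_interior_subset K ⟨x, hx, rfl⟩)
  simpa using h

lemma isCompact_smul_S₀ (c : ℝ) : IsCompact (c • S₀) := by
  have h : IsCompact S₀ := (Set.toFinite _).isCompact_convexHull ℝ
  exact h.smul c

lemma mul_sub_le_width (f : (Fin 4 → ℝ) →ₗ[ℝ] ℝ) (c : ℝ) {v w : Fin 4 → ℝ}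
    (hv : v ∈ S₀) (hw : w ∈ S₀) :
    c * (f v - f w) ≤ sSup (f '' (c • S₀)) - sInf (f '' (c • S₀)) := by
  have hK : IsCompact (f '' (c • S₀)) :=
    (isCompact_smul_S₀ c).image f.continuous_of_finiteDimensional
  have h1 : f (c • v) ≤ sSup (f '' (c • S₀)) :=
    le_csSup hK.bddAbove ⟨_, smul_mem_smul_set hv, rfl⟩
  have h2 : sInf (f '' (c • S₀)) ≤ f (c • w) :=
    csInf_le hK.bddBelow ⟨_, smul_mem_smul_set hw, rfl⟩
  simp only [map_smul, smul_eq_mul] at h1 h2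
  linarith

/-- The linear functional on `ℝ⁴` with coefficient vector `a`. -/
noncomputable def coeffFunctional (a : Fin 4 → ℝ) : (Fin 4 → ℝ) →ₗ[ℝ] ℝ :=
  Fintype.linearCombination ℝ a

lemma coeffFunctional_apply (a x : Fin 4 → ℝ) :
    coeffFunctional a x = x 0 * a 0 + x 1 * a 1 + x 2 * a 2 + x 3 * a 3 := by
  simp [coeffFunctional, Fintype.linearCombination_apply, Fin.sum_univ_four]

lemma coeffFunctional_ne_zero {a : Fin 4 → ℝ} (ha : a 3 ≠ 0) : coeffFunctional a ≠ 0 := by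
  intro h
  have := LinearMap.congr_fun h ![0, 0, 0, 1]
  simp [coeffFunctional_apply, ha] at this

lemma no_small_simplex_coordinates (x y z t : ℤ) (ht : 0 < t) (hx : 6 * t < 101 * x)
    (hy : 14 * t < 101 * y) (hz : 17 * t < 101 * z) :
    102 ≤ 101 * (x + y + z) - 36 * t := by
  by_contra! h
  have ht' : t ≤ 98 := by omega
  interval_cases t <;> omega

lemma coeffs_eq_zero_of_small_width (p q r s : ℤ)
    (hp : |p| ≤ 3) (hq : |q| ≤ 3) (hr : |r| ≤ 3) (hs : |6 * p + 14 * q + 17 * r + 101 * s| ≤ 3)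
    (hpq : |p - q| ≤ 3) (hpr : |p - r| ≤ 3) (hqr : |q - r| ≤ 3)
    (hps : |6 * p + 14 * q + 17 * r + 101 * s - p| ≤ 3)
    (hqs : |6 * p + 14 * q + 17 * r + 101 * s - q| ≤ 3)
    (hrs : |6 * p + 14 * q + 17 * r + 101 * s - r| ≤ 3) :
    p = 0 ∧ q = 0 ∧ r = 0 ∧ s = 0 := by
  simp only [abs_le] at *
  obtain ⟨_, _⟩ := hp
  obtain ⟨_, _⟩ := hq
  obtain ⟨_, _⟩ := hr
  interval_cases p <;> interval_cases q <;> first | omega | (interval_cases r <;> omega)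

lemma exists_int_coeffs (f : (Fin 4 → ℝ) →ₗ[ℝ] ℝ)
    (hf : ∀ v : Fin 4 → ℤ, ∃ k : ℤ, f (fun i => (v i : ℝ)) = (k : ℝ)) :
    ∃ a : Fin 4 → ℤ, f = coeffFunctional (fun i => (a i : ℝ)) := by
  choose a ha using fun i : Fin 4 => hf (fun j => if i = j then 1 else 0)
  refine ⟨a, LinearMap.ext fun x => ?_⟩
  rw [LinearMap.pi_apply_eq_sum_univ f x, coeffFunctional_apply, Fin.sum_univ_four]
  simp only [← ha, smul_eq_mul, Int.cast_ite, Int.cast_one, Int.cast_zero]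

lemma width_lower_bound (f : (Fin 4 → ℝ) →ₗ[ℝ] ℝ)
    (hf : ∀ v : Fin 4 → ℤ, ∃ k : ℤ, f (fun i => (v i : ℝ)) = (k : ℝ)) (hf0 : f ≠ 0) :
    408 / 101 ≤ sSup (f '' ((102 / 101 : ℝ) • S₀)) - sInf (f '' ((102 / 101 : ℝ) • S₀)) := by
  by_contra! hlt
  obtain ⟨a, rfl⟩ := exists_int_coeffs f hf
  set f := coeffFunctional (fun i => (a i : ℝ)) with hfdef
  have key : ∀ v ∈ S₀, ∀ w ∈ S₀, ∀ m n : ℤ, f v = m → f w = n → |m - n| ≤ 3 := by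
    have aux : ∀ v ∈ S₀, ∀ w ∈ S₀, ∀ m n : ℤ, f v = m → f w = n → m - n ≤ 3 := by
      intro v hv w hw m n hm hn
      have h := mul_sub_le_width f (102 / 101) hv hw
      rw [hm, hn] at h
      have h4 : ((m - n : ℤ) : ℝ) < (4 : ℤ) := by
        push_cast
        linarith
      have := Int.cast_lt.1 h4
      omega
    intro v hv w hw m n hm hn
    have h1 := aux v hv w hw m n hm hn
    have h2 := aux w hw v hv n m hn hm
    exact abs_le.2 ⟨by omega, h1⟩
  have v0 : ![0, 0, 0, 0] ∈ S₀ := subset_convexHull ℝ _ (by simp)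
  have v1 : ![1, 0, 0, 0] ∈ S₀ := subset_convexHull ℝ _ (by simp)
  have v2 : ![0, 1, 0, 0] ∈ S₀ := subset_convexHull ℝ _ (by simp)
  have v3 : ![0, 0, 1, 0] ∈ S₀ := subset_convexHull ℝ _ (by simp)
  have v4 : ![6, 14, 17, 101] ∈ S₀ := subset_convexHull ℝ _ (by simp)
  have f0 : f ![0, 0, 0, 0] = (0 : ℤ) := by simp [hfdef, coeffFunctional_apply]
  have f1 : f ![1, 0, 0, 0] = a 0 := by simp [hfdef, coeffFunctional_apply]
  have f2 : f ![0, 1, 0, 0] = a 1 := by simp [hfdef, coeffFunctional_apply]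
  have f3 : f ![0, 0, 1, 0] = a 2 := by simp [hfdef, coeffFunctional_apply]
  have f4 : f ![6, 14, 17, 101] = (6 * a 0 + 14 * a 1 + 17 * a 2 + 101 * a 3 : ℤ) := by
    simp [hfdef, coeffFunctional_apply]
  obtain ⟨h0, h1, h2, h3⟩ := coeffs_eq_zero_of_small_width (a 0) (a 1) (a 2) (a 3)
    (by simpa using key _ v1 _ v0 _ _ f1 f0) (by simpa using key _ v2 _ v0 _ _ f2 f0)
    (by simpa using key _ v3 _ v0 _ _ f3 f0)
    (by simpa only [sub_zero] using key _ v4 _ v0 _ _ f4 f0)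
    (key _ v1 _ v2 _ _ f1 f2) (key _ v1 _ v3 _ _ f1 f3) (key _ v2 _ v3 _ _ f2 f3)
    (key _ v4 _ v1 _ _ f4 f1) (key _ v4 _ v2 _ _ f4 f2) (key _ v4 _ v3 _ _ f4 f3)
  exact hf0 (LinearMap.ext fun x => by simp [hfdef, coeffFunctional_apply, h0, h1, h2, h3])

lemma exists_width_eq :
    ∃ f : (Fin 4 → ℝ) →ₗ[ℝ] ℝ,
      (∀ v : Fin 4 → ℤ, ∃ k : ℤ, f (fun i => (v i : ℝ)) = (k : ℝ)) ∧ f ≠ 0 ∧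
      (408 / 101 : ℝ) =
        sSup (f '' ((102 / 101 : ℝ) • S₀)) - sInf (f '' ((102 / 101 : ℝ) • S₀)) := by
  have hint : ∀ v : Fin 4 → ℤ, ∃ k : ℤ,
      coeffFunctional ![-4, -2, -3, 1] (fun i => (v i : ℝ)) = (k : ℝ) := fun v =>
    ⟨v 0 * -4 + v 1 * -2 + v 2 * -3 + v 3 * 1, by simp [coeffFunctional_apply]⟩
  have hne : coeffFunctional ![-4, -2, -3, 1] ≠ 0 := coeffFunctional_ne_zero (by simp)
  refine ⟨coeffFunctional ![-4, -2, -3, 1], hint, hne,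
    le_antisymm (width_lower_bound _ hint hne) ?_⟩
  have hS : (coeffFunctional ![-4, -2, -3, 1] '' ((102 / 101 : ℝ) • S₀)).Nonempty :=
    ⟨_, _, smul_mem_smul_set (subset_convexHull ℝ _ (mem_insert _ _)), rfl⟩
  have hle := le_mul_of_mem_smul_S₀ (coeffFunctional ![-4, -2, -3, 1])
    (c := 102 / 101) (M := 0) (by norm_num) (by simp [coeffFunctional_apply]; norm_num)
  have hge := le_mul_of_mem_smul_S₀ (-coeffFunctional ![-4, -2, -3, 1])
    (c := 102 / 101) (M := 4) (by norm_num) (by simp [coeffFunctional_apply]; norm_num)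
  have h1 := csSup_le hS (forall_mem_image.2 hle)
  have h2 : (-408 / 101 : ℝ) ≤
      sInf (coeffFunctional ![-4, -2, -3, 1] '' ((102 / 101 : ℝ) • S₀)) :=
    le_csInf hS (forall_mem_image.2 fun x hx => by
      have := hge x hx
      rw [LinearMap.neg_apply] at this
      linarith)
  linarith

theorem dilated_simplex_hollow_and_width :
    (∀ z : Fin 4 → ℤ,
      (fun i => (z i : ℝ)) ∉ interior ((102 / 101 : ℝ) • S₀)) ∧
    latticeWidth ((102 / 101 : ℝ) • S₀) = 408 / 101 := by
  refine ⟨fun z hz => ?_, ?_⟩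
  · have bound : ∀ a : Fin 4 → ℝ, a 3 ≠ 0 → ∀ M : ℝ,
        (∀ v ∈ ({![0, 0, 0, 0], ![1, 0, 0, 0], ![0, 1, 0, 0], ![0, 0, 1, 0],
          ![6, 14, 17, 101]} : Set (Fin 4 → ℝ)), coeffFunctional a v ≤ M) →
        z 0 * a 0 + z 1 * a 1 + z 2 * a 2 + z 3 * a 3 < 102 / 101 * M := fun a ha M hM => by
      rw [← coeffFunctional_apply a (fun i => (z i : ℝ))]
      exact lt_of_mem_interior_of_forall_le _ (coeffFunctional_ne_zero ha)
        (le_mul_of_mem_smul_S₀ _ (by norm_num) hM) hz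
    have ht := bound ![0, 0, 0, -1] (by simp) 0 (by simp [coeffFunctional_apply])
    have hx := bound ![-101, 0, 0, 6] (by simp) 0 (by simp [coeffFunctional_apply]; norm_num)
    have hy := bound ![0, -101, 0, 14] (by simp) 0 (by simp [coeffFunctional_apply]; norm_num)
    have hw := bound ![0, 0, -101, 17] (by simp) 0 (by simp [coeffFunctional_apply]; norm_num)
    have hs := bound ![101, 101, 101, -36] (by simp) 101
      (by simp [coeffFunctional_apply]; norm_num)
    simp only [Matrix.cons_val] at ht hx hy hw hs
    have h := no_small_simplex_coordinates (z 0) (z 1) (z 2) (z 3)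
      (by have : (0 : ℝ) < z 3 := by linarith
          exact_mod_cast this)
      (by have : (6 * z 3 : ℝ) < 101 * z 0 := by linarith
          exact_mod_cast this)
      (by have : (14 * z 3 : ℝ) < 101 * z 1 := by linarith
          exact_mod_cast this)
      (by have : (17 * z 3 : ℝ) < 101 * z 2 := by linarith
          exact_mod_cast this)
    have h' : (102 : ℝ) ≤ 101 * (z 0 + z 1 + z 2) - 36 * z 3 := by exact_mod_cast h
    linarith
  · refine IsLeast.csInf_eq ⟨exists_width_eq, ?_⟩
    rintro _ ⟨f, hf, hf0, rfl⟩
    exact width_lower_bound f hf hf0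
end

section
/- The sequence w_c(d)/d converges in [0,∞] as d → ∞, and its limit equals sup_{d≥1} w_c(d)/d. -/
open Set ENNReal Filter

/-- `w_c(n)`: the supremum in `[0,∞]` of the lattice widths of all hollow convex
bodies in `ℝ^n`. -/
noncomputable def wc (n : ℕ) : ℝ≥0∞ :=
  ⨆ (K : Set (Fin n → ℝ)) (_ : IsCompact K) (_ : Convex ℝ K)
    (_ : (interior K).Nonempty)
    (_ : ∀ z : Fin n → ℤ, (fun i => (z i : ℝ)) ∉ interior K),
    ENNReal.ofReal (latticeWidth K)

/-- A linear functional on `ℝ^ι` mapping `ℤ^ι` into `ℤ`. -/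
def IsIntegerFunctional {ι : Type*} (f : (ι → ℝ) →ₗ[ℝ] ℝ) : Prop :=
  ∀ v : ι → ℤ, ∃ k : ℤ, f (fun i => (v i : ℝ)) = (k : ℝ)

/-- `K` is a hollow convex body. -/
structure IsHollowBody {ι : Type*} (K : Set (ι → ℝ)) : Prop where
  isCompact : IsCompact K
  convex : Convex ℝ K
  nonempty_interior : (interior K).Nonempty
  hollow : ∀ z : ι → ℤ, (fun i => (z i : ℝ)) ∉ interior K

/-- Every nonzero integer functional varies by at least `w` on `K`. -/
def HasWidthAtLeast {ι : Type*} (K : Set (ι → ℝ)) (w : ℝ) : Prop :=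
  ∀ f : (ι → ℝ) →ₗ[ℝ] ℝ, IsIntegerFunctional f → f ≠ 0 → ∃ x ∈ K, ∃ y ∈ K, w ≤ f x - f y

/-- There is a hollow convex body in `ℝ^n` of lattice width at least `w > 0`. -/
def IsHollowWidth (n : ℕ) (w : ℝ) : Prop :=
  0 < w ∧ ∃ K : Set (Fin n → ℝ), IsHollowBody K ∧ HasWidthAtLeast K w

theorem hasWidthAtLeast_latticeWidth {n : ℕ} {K : Set (Fin n → ℝ)} (hK : IsCompact K)
    (hne : K.Nonempty) : HasWidthAtLeast K (latticeWidth K) := by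
  intro f hf hf0
  have hc : IsCompact (f '' K) := hK.image f.continuous_of_finiteDimensional
  obtain ⟨x, hx, hfx⟩ := hc.sSup_mem (hne.image f)
  obtain ⟨y, hy, hfy⟩ := hc.sInf_mem (hne.image f)
  refine ⟨x, hx, y, hy, ?_⟩
  rw [hfx, hfy]
  refine csInf_le ⟨0, ?_⟩ ⟨f, hf, hf0, rfl⟩
  rintro _ ⟨g, -, -, rfl⟩
  have hg : IsCompact (g '' K) := hK.image g.continuous_of_finiteDimensional
  exact sub_nonneg.2 (csInf_le_csSup (hne.image g) hg.bddBelow hg.bddAbove)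

theorem isIntegerFunctional_proj {ι : Type*} (i : ι) :
    IsIntegerFunctional (LinearMap.proj i : (ι → ℝ) →ₗ[ℝ] ℝ) :=
  fun v => ⟨v i, rfl⟩

theorem HasWidthAtLeast.le_latticeWidth {n : ℕ} (hn : 0 < n) {K : Set (Fin n → ℝ)}
    (hK : IsCompact K) {w : ℝ} (hw : HasWidthAtLeast K w) : w ≤ latticeWidth K := by
  refine le_csInf ⟨_, LinearMap.proj ⟨0, hn⟩, isIntegerFunctional_proj _, ?_, rfl⟩ ?_
  · intro h
    simpa using LinearMap.congr_fun h (fun _ => 1)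
  · rintro _ ⟨f, hf, hf0, rfl⟩
    obtain ⟨x, hx, y, hy, hxy⟩ := hw f hf hf0
    have hc : IsCompact (f '' K) := hK.image f.continuous_of_finiteDimensional
    have h₁ := le_csSup hc.bddAbove (mem_image_of_mem f hx)
    have h₂ := csInf_le hc.bddBelow (mem_image_of_mem f hy)
    linarith

theorem IsHollowWidth.ofReal_le_wc {n : ℕ} (hn : 0 < n) {w : ℝ} (h : IsHollowWidth n w) :
    ENNReal.ofReal w ≤ wc n := by
  obtain ⟨-, K, hK, hw⟩ := h
  refine (ENNReal.ofReal_le_ofReal (hw.le_latticeWidth hn hK.isCompact)).trans ?_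
  unfold wc
  exact le_iSup_of_le K <| le_iSup_of_le hK.isCompact <| le_iSup_of_le hK.convex <|
    le_iSup_of_le hK.nonempty_interior <| le_iSup_of_le hK.hollow le_rfl

theorem exists_isHollowWidth_of_lt_wc {n : ℕ} {c : ℝ≥0∞} (hc : c < wc n) :
    ∃ w, IsHollowWidth n w ∧ c < ENNReal.ofReal w := by
  simp only [wc, lt_iSup_iff] at hc
  obtain ⟨K, h₁, h₂, h₃, h₄, h⟩ := hc
  exact ⟨latticeWidth K, ⟨ENNReal.ofReal_pos.1 (bot_le.trans_lt h), K, ⟨h₁, h₂, h₃, h₄⟩,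
    hasWidthAtLeast_latticeWidth h₁ (h₃.mono interior_subset)⟩, h⟩

theorem isHollowBody_Icc {n : ℕ} (hn : 0 < n) :
    IsHollowBody (Icc (0 : Fin n → ℝ) 1) := by
  have hint : interior (Icc (0 : Fin n → ℝ) 1) = univ.pi fun _ => Ioo (0 : ℝ) 1 := by
    rw [← pi_univ_Icc, interior_pi_set finite_univ]
    simp
  refine ⟨isCompact_Icc, convex_Icc _ _, ?_, ?_⟩
  · rw [hint]
    exact ⟨fun _ => 1 / 2, fun _ _ => by norm_num⟩
  · intro z hz
    rw [hint] at hz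
    obtain ⟨h₀, h₁⟩ := hz ⟨0, hn⟩ (mem_univ _)
    beta_reduce at h₀ h₁
    have h₀' : 0 < z ⟨0, hn⟩ := by exact_mod_cast h₀
    have h₁' : z ⟨0, hn⟩ < 1 := by exact_mod_cast h₁
    lia

theorem hasWidthAtLeast_Icc (n : ℕ) : HasWidthAtLeast (Icc (0 : Fin n → ℝ) 1) 1 := by
  intro f hf hf0
  obtain ⟨i, hi⟩ : ∃ i, f (Pi.single i 1) ≠ 0 := by
    by_contra! h
    exact hf0 (LinearMap.pi_ext' fun i => LinearMap.ext_ring (by simpa using h i))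
  obtain ⟨k, hk⟩ := hf (Pi.single i 1)
  have he : (fun j => ((Pi.single i 1 : Fin n → ℤ) j : ℝ)) = Pi.single i 1 := by
    ext j
    rcases eq_or_ne j i with rfl | h <;> simp [*]
  rw [he] at hk
  have hmem : (Pi.single i 1 : Fin n → ℝ) ∈ Icc (0 : Fin n → ℝ) 1 := by
    constructor <;> intro j <;> rcases eq_or_ne j i with rfl | h <;> simp [*]
  have h0 : (0 : Fin n → ℝ) ∈ Icc (0 : Fin n → ℝ) 1 := ⟨le_rfl, zero_le_one⟩
  have hk0 : k ≠ 0 := by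
    rintro rfl
    exact hi (by simpa using hk)
  rcases lt_or_gt_of_ne hk0 with h | h
  · refine ⟨0, h0, _, hmem, ?_⟩
    have : (k : ℝ) ≤ -1 := by exact_mod_cast (show k ≤ -1 by lia)
    rw [map_zero, hk]
    linarith
  · refine ⟨_, hmem, 0, h0, ?_⟩
    have : (1 : ℝ) ≤ k := by exact_mod_cast (show 1 ≤ k by lia)
    rw [map_zero, hk]
    linarith

theorem isHollowWidth_one {n : ℕ} (hn : 0 < n) : IsHollowWidth n 1 :=
  ⟨one_pos, _, isHollowBody_Icc hn, hasWidthAtLeast_Icc n⟩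

theorem IsHollowWidth.mono {n : ℕ} {v w : ℝ} (h : IsHollowWidth n w) (hv : 0 < v) (hvw : v ≤ w) :
    IsHollowWidth n v := by
  obtain ⟨-, K, hK, hw⟩ := h
  refine ⟨hv, K, hK, fun f hf hf0 => ?_⟩
  obtain ⟨x, hx, y, hy, hxy⟩ := hw f hf hf0
  exact ⟨x, hx, y, hy, hvw.trans hxy⟩

open scoped Pointwise in
theorem Convex.exists_smul_add_smul_eq {E : Type*} [AddCommGroup E] [Module ℝ E] {K : Set E}
    (hK : Convex ℝ K) {x y : E} (hx : x ∈ K) (hy : y ∈ K) {s t : ℝ} (hs : 0 ≤ s) (ht : 0 ≤ t) :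
    ∃ z ∈ K, s • x + t • y = (s + t) • z := by
  have h : s • x + t • y ∈ (s + t) • K := by
    rw [hK.add_smul hs ht]
    exact add_mem_add (smul_mem_smul_set hx) (smul_mem_smul_set hy)
  obtain ⟨z, hz, h⟩ := h
  exact ⟨z, hz, h.symm⟩

/-- A convex set is star-shaped about an interior point, with the open segments in the interior. -/
theorem Convex.one_le_of_add_smul_sub_notMem_interior {E : Type*} [AddCommGroup E] [Module ℝ E]
    [TopologicalSpace E] [IsTopologicalAddGroup E] [ContinuousSMul ℝ E] {K : Set E}
    (hK : Convex ℝ K) {a x : E} (ha : a ∈ interior K) (hx : x ∈ K) {s : ℝ} (hs : 0 ≤ s)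
    (h : a + s • (x - a) ∉ interior K) : 1 ≤ s := by
  by_contra! hs1
  refine h ?_
  have := hK.combo_interior_self_mem_interior ha hx (sub_pos.2 hs1) hs (by ring)
  convert this using 1
  module

/-- The parametrisation of the direct sum of `α (K - a)` and `β (L - b)`, recentred at
`(a, b)`. -/
def directSumPoint {m n : ℕ} (a : Fin m → ℝ) (b : Fin n → ℝ) (α β : ℝ)
    (p : ℝ × (Fin m → ℝ) × (Fin n → ℝ)) : Fin (m + n) → ℝ :=
  Fin.append (a + (p.1 * α) • (p.2.1 - a)) (b + ((1 - p.1) * β) • (p.2.2 - b))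

/-- The direct sum of `α (K - a)` and `β (L - b)`, recentred at `(a, b)`. -/
def directSumBody {m n : ℕ} (K : Set (Fin m → ℝ)) (L : Set (Fin n → ℝ)) (a : Fin m → ℝ)
    (b : Fin n → ℝ) (α β : ℝ) : Set (Fin (m + n) → ℝ) :=
  directSumPoint a b α β '' (Icc 0 1 ×ˢ K ×ˢ L)

/-- Extension by zero on the right, `ℝ^m → ℝ^(m+n)`. -/
def appendZero (m n : ℕ) : (Fin m → ℝ) →ₗ[ℝ] (Fin (m + n) → ℝ) where
  toFun x := Fin.append x 0
  map_add' x y := by ext i; refine Fin.addCases (fun i => ?_) (fun i => ?_) i <;> simp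
  map_smul' c x := by ext i; refine Fin.addCases (fun i => ?_) (fun i => ?_) i <;> simp

/-- Extension by zero on the left, `ℝ^n → ℝ^(m+n)`. -/
def zeroAppend (m n : ℕ) : (Fin n → ℝ) →ₗ[ℝ] (Fin (m + n) → ℝ) where
  toFun x := Fin.append 0 x
  map_add' x y := by ext i; refine Fin.addCases (fun i => ?_) (fun i => ?_) i <;> simp
  map_smul' c x := by ext i; refine Fin.addCases (fun i => ?_) (fun i => ?_) i <;> simp

theorem append_eq_appendZero_add_zeroAppend {m n : ℕ} (x : Fin m → ℝ) (y : Fin n → ℝ) :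
    Fin.append x y = appendZero m n x + zeroAppend m n y := by
  ext i
  refine Fin.addCases (fun i => ?_) (fun i => ?_) i <;> simp [appendZero, zeroAppend]

theorem IsIntegerFunctional.comp_appendZero {m n : ℕ} {f : (Fin (m + n) → ℝ) →ₗ[ℝ] ℝ}
    (hf : IsIntegerFunctional f) : IsIntegerFunctional (f ∘ₗ appendZero m n) := by
  intro v
  obtain ⟨k, hk⟩ := hf (Fin.append v 0)
  refine ⟨k, hk ▸ congrArg f ?_⟩
  ext i
  refine Fin.addCases (fun i => ?_) (fun i => ?_) i <;> simp [appendZero]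

theorem IsIntegerFunctional.comp_zeroAppend {m n : ℕ} {f : (Fin (m + n) → ℝ) →ₗ[ℝ] ℝ}
    (hf : IsIntegerFunctional f) : IsIntegerFunctional (f ∘ₗ zeroAppend m n) := by
  intro v
  obtain ⟨k, hk⟩ := hf (Fin.append 0 v)
  refine ⟨k, hk ▸ congrArg f ?_⟩
  ext i
  refine Fin.addCases (fun i => ?_) (fun i => ?_) i <;> simp [zeroAppend]

section DirectSum

variable {m n : ℕ} {K : Set (Fin m → ℝ)} {L : Set (Fin n → ℝ)} {a : Fin m → ℝ} {b : Fin n → ℝ}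
  {α β : ℝ}

theorem mem_directSumBody {z : Fin (m + n) → ℝ} :
    z ∈ directSumBody K L a b α β ↔ ∃ t ∈ Icc (0 : ℝ) 1, ∃ x ∈ K, ∃ y ∈ L,
      (fun i => z (Fin.castAdd n i)) = a + (t * α) • (x - a) ∧
      (fun i => z (Fin.natAdd m i)) = b + ((1 - t) * β) • (y - b) := by
  constructor
  · rintro ⟨⟨t, x, y⟩, ⟨ht, hx, hy⟩, rfl⟩
    exact ⟨t, ht, x, hx, y, hy, by ext; simp [directSumPoint], by ext; simp [directSumPoint]⟩
  · rintro ⟨t, ht, x, hx, y, hy, h₁, h₂⟩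
    refine ⟨⟨t, x, y⟩, ⟨ht, hx, hy⟩, ?_⟩
    ext i
    refine Fin.addCases (fun i => ?_) (fun i => ?_) i
    · simpa [directSumPoint] using (congrFun h₁ i).symm
    · simpa [directSumPoint] using (congrFun h₂ i).symm

theorem IsCompact.directSumBody (hK : IsCompact K) (hL : IsCompact L) :
    IsCompact (directSumBody K L a b α β) := by
  refine (isCompact_Icc.prod (hK.prod hL)).image (continuous_pi fun i => ?_)
  refine Fin.addCases (fun i => ?_) (fun i => ?_) i <;> simp only [directSumPoint,
    Fin.append_left, Fin.append_right, Pi.add_apply, Pi.smul_apply, Pi.sub_apply] <;> fun_prop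

theorem Convex.directSumBody (hK : Convex ℝ K) (hL : Convex ℝ L) :
    Convex ℝ (directSumBody K L a b α β) := by
  intro z hz z' hz' s s' hs hs' hss
  rw [mem_directSumBody] at hz hz' ⊢
  obtain ⟨t, ht, x, hx, y, hy, h₁, h₂⟩ := hz
  obtain ⟨t', ht', x', hx', y', hy', h₁', h₂'⟩ := hz'
  obtain ⟨X, hX, hXe⟩ := hK.exists_smul_add_smul_eq hx hx' (mul_nonneg hs ht.1)
    (mul_nonneg hs' ht'.1)
  obtain ⟨Y, hY, hYe⟩ := hL.exists_smul_add_smul_eq hy hy' (mul_nonneg hs (sub_nonneg.2 ht.2))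
    (mul_nonneg hs' (sub_nonneg.2 ht'.2))
  have hs1 : s' = 1 - s := by linarith
  refine ⟨s * t + s' * t', ⟨?_, ?_⟩, X, hX, Y, hY, ?_, ?_⟩
  · exact add_nonneg (mul_nonneg hs ht.1) (mul_nonneg hs' ht'.1)
  · nlinarith [mul_le_mul_of_nonneg_left ht.2 hs, mul_le_mul_of_nonneg_left ht'.2 hs']
  · ext i
    have e₁ := congrFun h₁ i
    have e₁' := congrFun h₁' i
    have e := congrFun hXe i
    simp only [Pi.add_apply, Pi.smul_apply, Pi.sub_apply, smul_eq_mul] at *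
    rw [e₁, e₁', hs1] at *
    linear_combination α * e
  · ext i
    have e₂ := congrFun h₂ i
    have e₂' := congrFun h₂' i
    have e := congrFun hYe i
    simp only [Pi.add_apply, Pi.smul_apply, Pi.sub_apply, smul_eq_mul] at *
    rw [e₂, e₂', hs1] at *
    linear_combination β * e

theorem nonempty_interior_directSumBody (ha : a ∈ interior K) (hb : b ∈ interior L)
    (hα : 0 < α) (hβ : 0 < β) : (interior (directSumBody K L a b α β)).Nonempty := by
  let g : (Fin (m + n) → ℝ) → (Fin m → ℝ) :=
    fun z => a + (2 / α) • ((fun i => z (Fin.castAdd n i)) - a)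
  let h : (Fin (m + n) → ℝ) → (Fin n → ℝ) :=
    fun z => b + (2 / β) • ((fun i => z (Fin.natAdd m i)) - b)
  have hg : Continuous g := by fun_prop
  have hh : Continuous h := by fun_prop
  refine ⟨Fin.append a b, mem_interior.2 ⟨g ⁻¹' interior K ∩ h ⁻¹' interior L, ?_,
    (isOpen_interior.preimage hg).inter (isOpen_interior.preimage hh), ?_, ?_⟩⟩
  · rintro z ⟨hz₁, hz₂⟩
    refine mem_directSumBody.2 ⟨1 / 2, by norm_num, g z, interior_subset hz₁, h z,
      interior_subset hz₂, ?_, ?_⟩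
    · ext i
      simp only [g, Pi.add_apply, Pi.smul_apply, Pi.sub_apply, smul_eq_mul]
      field_simp
      ring
    · ext i
      simp only [h, Pi.add_apply, Pi.smul_apply, Pi.sub_apply, smul_eq_mul]
      field_simp
      ring
  · have : g (Fin.append a b) = a := by ext i; simp [g]
    rwa [mem_preimage, this]
  · have : h (Fin.append a b) = b := by ext i; simp [h]
    rwa [mem_preimage, this]

theorem IsHollowBody.directSumBody (hK : IsHollowBody K) (hL : IsHollowBody L)
    (ha : a ∈ interior K) (hb : b ∈ interior L) (hα : 0 < α) (hβ : 0 < β)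
    (hαβ : α⁻¹ + β⁻¹ = 1) : IsHollowBody (directSumBody K L a b α β) := by
  refine ⟨hK.isCompact.directSumBody hL.isCompact, hK.convex.directSumBody hL.convex,
    nonempty_interior_directSumBody ha hb hα hβ, fun z hz => ?_⟩
  set p : Fin (m + n) → ℝ := fun i => (z i : ℝ) with hp
  have hcont : Continuous fun ε : ℝ => p + ε • (p - Fin.append a b) := by fun_prop
  have hev : ∀ᶠ ε in nhds (0 : ℝ), p + ε • (p - Fin.append a b) ∈
      interior (_root_.directSumBody K L a b α β) :=
    hcont.continuousAt.eventually_mem (isOpen_interior.mem_nhds (by simpa using hz))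
  obtain ⟨ε, hmem, hε⟩ := ((hev.filter_mono nhdsWithin_le_nhds).and
    (self_mem_nhdsWithin : Ioi (0 : ℝ) ∈ nhdsWithin 0 (Ioi 0))).exists
  have hε0 : (0 : ℝ) < 1 + ε := by
    have : (0 : ℝ) < ε := hε
    linarith
  obtain ⟨t, ht, x, hx, y, hy, h₁, h₂⟩ := mem_directSumBody.1 (interior_subset hmem)
  have hs : 1 ≤ t * α / (1 + ε) := by
    refine hK.convex.one_le_of_add_smul_sub_notMem_interior ha hx
      (div_nonneg (mul_nonneg ht.1 hα.le) hε0.le) ?_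
    convert hK.hollow (fun i => z (Fin.castAdd n i)) using 2
    ext i
    have e := congrFun h₁ i
    simp only [hp, Pi.add_apply, Pi.smul_apply, Pi.sub_apply, smul_eq_mul,
      Fin.append_left] at e ⊢
    field_simp
    linear_combination -e
  have hs' : 1 ≤ (1 - t) * β / (1 + ε) := by
    refine hL.convex.one_le_of_add_smul_sub_notMem_interior hb hy
      (div_nonneg (mul_nonneg (sub_nonneg.2 ht.2) hβ.le) hε0.le) ?_
    convert hL.hollow (fun i => z (Fin.natAdd m i)) using 2
    ext i
    have e := congrFun h₂ i
    simp only [hp, Pi.add_apply, Pi.smul_apply, Pi.sub_apply, smul_eq_mul,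
      Fin.append_right] at e ⊢
    field_simp
    linear_combination -e
  rw [le_div_iff₀ hε0, one_mul] at hs hs'
  have k₁ : (1 + ε) * α⁻¹ ≤ t := by rwa [← div_eq_mul_inv, div_le_iff₀ hα]
  have k₂ : (1 + ε) * β⁻¹ ≤ 1 - t := by rwa [← div_eq_mul_inv, div_le_iff₀ hβ]
  have k₃ : (1 + ε) * (α⁻¹ + β⁻¹) ≤ 1 := by linarith
  rw [hαβ] at k₃
  have : (0 : ℝ) < ε := hε
  linarith

theorem HasWidthAtLeast.directSumBody {v w u : ℝ} (hK : HasWidthAtLeast K v)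
    (hL : HasWidthAtLeast L w) (ha : a ∈ K) (hb : b ∈ L) (hα : 0 ≤ α) (hβ : 0 ≤ β)
    (hv : u ≤ α * v) (hw : u ≤ β * w) : HasWidthAtLeast (directSumBody K L a b α β) u := by
  intro f hf hf0
  by_cases h₁ : f ∘ₗ appendZero m n = 0
  · have h₂ : f ∘ₗ zeroAppend m n ≠ 0 := by
      refine fun h₂ => hf0 (LinearMap.ext fun z => ?_)
      rw [← Fin.append_castAdd_natAdd (f := z), append_eq_appendZero_add_zeroAppend, map_add]
      simpa using congrArg₂ (· + ·) (LinearMap.congr_fun h₁ _) (LinearMap.congr_fun h₂ _)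
    obtain ⟨x, hx, y, hy, hxy⟩ := hL _ hf.comp_zeroAppend h₂
    refine ⟨_, ⟨(0, a, x), ⟨by simp, ha, hx⟩, rfl⟩, _, ⟨(0, a, y), ⟨by simp, ha, hy⟩, rfl⟩, ?_⟩
    have := mul_le_mul_of_nonneg_left hxy hβ
    simp only [LinearMap.comp_apply] at this
    simp only [directSumPoint, append_eq_appendZero_add_zeroAppend, map_add, map_smul, map_sub,
      smul_eq_mul]
    linarith
  · obtain ⟨x, hx, y, hy, hxy⟩ := hK _ hf.comp_appendZero h₁
    refine ⟨_, ⟨(1, x, b), ⟨by simp, hx, hb⟩, rfl⟩, _, ⟨(1, y, b), ⟨by simp, hy, hb⟩, rfl⟩, ?_⟩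
    have := mul_le_mul_of_nonneg_left hxy hα
    simp only [LinearMap.comp_apply] at this
    simp only [directSumPoint, append_eq_appendZero_add_zeroAppend, map_add, map_smul, map_sub,
      smul_eq_mul]
    linarith

end DirectSum

theorem IsHollowWidth.add {m n : ℕ} {v w : ℝ} (hv : IsHollowWidth m v) (hw : IsHollowWidth n w) :
    IsHollowWidth (m + n) (v + w) := by
  obtain ⟨hv0, K, hK, hKw⟩ := hv
  obtain ⟨hw0, L, hL, hLw⟩ := hw
  obtain ⟨a, ha⟩ := hK.nonempty_interior
  obtain ⟨b, hb⟩ := hL.nonempty_interior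
  have hα : 0 < (v + w) / v := by positivity
  have hβ : 0 < (v + w) / w := by positivity
  refine ⟨add_pos hv0 hw0, directSumBody K L a b ((v + w) / v) ((v + w) / w),
    hK.directSumBody hL ha hb hα hβ ?_,
    hKw.directSumBody hLw (interior_subset ha) (interior_subset hb) hα.le hβ.le ?_ ?_⟩
  · rw [inv_div, inv_div, ← add_div, div_self (add_pos hv0 hw0).ne']
  · rw [div_mul_cancel₀ _ hv0.ne']
  · rw [div_mul_cancel₀ _ hw0.ne']

theorem IsHollowWidth.mul {d : ℕ} {w : ℝ} (h : IsHollowWidth d w) {q : ℕ} (hq : 0 < q) :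
    IsHollowWidth (d * q) (q * w) := by
  induction q, hq using Nat.le_induction with
  | base => simpa using h
  | succ q _ ih =>
    rw [Nat.mul_succ, Nat.cast_succ, add_one_mul]
    exact ih.add h

theorem IsHollowWidth.div_mul {d n : ℕ} {w : ℝ} (h : IsHollowWidth d w) (hq : 0 < n / d) :
    IsHollowWidth n ((n / d : ℕ) * w) := by
  have hmul := h.mul hq
  rcases Nat.eq_zero_or_pos (n % d) with hr | hr
  · rwa [Nat.mul_div_cancel' (Nat.dvd_of_mod_eq_zero hr)] at hmul
  · have := hmul.add (isHollowWidth_one hr)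
    rw [Nat.div_add_mod] at this
    exact this.mono hmul.1 (by linarith)

theorem IsHollowWidth.eventually_lt_wc_div {d : ℕ} (hd : 0 < d) {w : ℝ} (h : IsHollowWidth d w)
    {c : ℝ} (hc : 0 ≤ c) (hcw : c * d < w) :
    ∀ᶠ n : ℕ in atTop, ENNReal.ofReal c < wc n / (n : ℝ≥0∞) := by
  have hdiv : Tendsto (fun n : ℕ => ((n / d : ℕ) : ℝ)) atTop atTop :=
    tendsto_natCast_atTop_atTop.comp (Nat.tendsto_div_const_atTop hd.ne')
  filter_upwards [hdiv.eventually_gt_atTop (c * d / (w - c * d)), hdiv.eventually_gt_atTop 0,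
    eventually_gt_atTop 0] with n hn hn0 hpos
  have hq : 0 < n / d := by exact_mod_cast hn0
  rw [div_lt_iff₀ (sub_pos.2 hcw)] at hn
  have hle : (n : ℝ) ≤ ((n / d : ℕ) : ℝ) * d + d := by
    have := Nat.div_add_mod n d
    have := Nat.mod_lt n hd
    exact_mod_cast (show n ≤ n / d * d + d by nlinarith)
  have hlt : c * n < (n / d : ℕ) * w := by nlinarith [mul_le_mul_of_nonneg_left hle hc]
  have hn' : (n : ℝ≥0∞) ≠ 0 := by exact_mod_cast hpos.ne'
  rw [ENNReal.lt_div_iff_mul_lt (Or.inl hn') (Or.inl (ENNReal.natCast_ne_top n))]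
  calc ENNReal.ofReal c * n = ENNReal.ofReal (c * n) := by
        rw [ENNReal.ofReal_mul hc, ENNReal.ofReal_natCast]
    _ < ENNReal.ofReal ((n / d : ℕ) * w) :=
        (ENNReal.ofReal_lt_ofReal_iff (h.div_mul hq).1).2 hlt
    _ ≤ wc n := (h.div_mul hq).ofReal_le_wc hpos

theorem tendsto_wc_div :
    Tendsto (fun d : ℕ => wc d / (d : ℝ≥0∞)) atTop
      (nhds (⨆ (d : ℕ) (_ : 0 < d), wc d / (d : ℝ≥0∞))) := by
  refine tendsto_order.2 ⟨fun c hc => ?_, fun c hc => ?_⟩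
  · obtain ⟨d, hd, hcd⟩ : ∃ d : ℕ, ∃ _ : 0 < d, c < wc d / (d : ℝ≥0∞) := by
      simpa only [lt_iSup_iff] using hc
    have hd' : (d : ℝ≥0∞) ≠ 0 := by exact_mod_cast hd.ne'
    rw [ENNReal.lt_div_iff_mul_lt (Or.inl hd') (Or.inl (ENNReal.natCast_ne_top d))] at hcd
    obtain ⟨w, hw, hcw⟩ := exists_isHollowWidth_of_lt_wc hcd
    have hc' : ENNReal.ofReal c.toReal = c := ENNReal.ofReal_toReal hc.ne_top
    rw [← hc', ← ENNReal.ofReal_natCast, ← ENNReal.ofReal_mul ENNReal.toReal_nonneg,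
      ENNReal.ofReal_lt_ofReal_iff hw.1] at hcw
    rw [← hc']
    exact hw.eventually_lt_wc_div hd ENNReal.toReal_nonneg hcw
  · filter_upwards [eventually_gt_atTop 0] with n hn
    exact (le_iSup₂ (f := fun (d : ℕ) (_ : 0 < d) => wc d / (d : ℝ≥0∞)) n hn).trans_lt hc
end
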